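/- Let N ≥ 2 and let X ⊆ ℂ^N be a connected open set admitting a C^∞ exhaustion function ρ : X → ℝ whose Levi form has at least two positive eigenvalues at every point of X. For x ∈ X and v ∈ ℂ^N define κ(x,v) := inf{λ > 0 : there is a holomorphic map f : Δ → X with f(0) = x and f'(0) = λ⁻¹·v}, where Δ ⊆ ℂ is the open unit disc, and define κ_prop(x,v) by the same formula where additionally f is required to be a proper map from Δ to X (both infima taken in [0,+∞] with inf ∅ = +∞). Then κ(x,v) = κ_prop(x,v) for every x ∈ X and v ∈ ℂ^N; that is, the infinitesimal Kobayashi–Royden pseudometric of X is computable in terms of proper holomorphic discs. -/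

import Mathlib

open Set Filter Complex Metric
open scoped ENNReal

noncomputable section

abbrev Cn (N : ℕ) := EuclideanSpace ℂ (Fin N)

def LeviForm {N : ℕ} (ρ : Cn N → ℝ) (x v : Cn N) : ℝ :=
  (1 / 4) * (iteratedFDeriv ℝ 2 ρ x ![v, v] +
    iteratedFDeriv ℝ 2 ρ x ![Complex.I • v, Complex.I • v])

def TwoPosEigen {N : ℕ} (ρ : Cn N → ℝ) (x : Cn N) : Prop :=
  ∃ W : Submodule ℂ (Cn N), Module.finrank ℂ W = 2 ∧
    ∀ v ∈ W, v ≠ 0 → 0 < LeviForm ρ x v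

/-- Admissible constants `λ > 0` for the Kobayashi–Royden pseudonorm of `v` at
`x`, computed with holomorphic discs `f : Δ → X`, `f(0) = x`, `f'(0) = λ⁻¹ v`;
when `proper = true` the discs are required to be proper maps `Δ → X`. -/
def kobSet {N : ℕ} (X : Set (Cn N)) (x : Cn N) (v : Cn N) (proper : Bool) : Set ℝ :=
  {lam : ℝ | 0 < lam ∧ ∃ f : ℂ → Cn N,
    DifferentiableOn ℂ f (ball (0:ℂ) 1) ∧
    (∀ z ∈ ball (0:ℂ) 1, f z ∈ X) ∧
    f 0 = x ∧ deriv f 0 = (lam⁻¹ : ℂ) • v ∧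
    (proper = true → ∀ K : Set (Cn N), K ⊆ X → IsCompact K →
      IsCompact {z ∈ ball (0:ℂ) 1 | f z ∈ K})}

/-- The Kobayashi–Royden pseudonorm (infimum in `[0,∞]`, `inf ∅ = ∞`). -/
def kob {N : ℕ} (X : Set (Cn N)) (x v : Cn N) (proper : Bool) : ℝ≥0∞ :=
  sInf (ENNReal.ofReal '' kobSet X x v proper)

noncomputable section
open Set Filter Complex Metric
open scoped ENNReal

/-- elements of the Fourier span are Laurent polynomials -/
lemma laurent_span (h : C(AddCircle (1:ℝ), ℂ)) (hh : h ∈ Submodule.span ℂ (range (fourier (T := (1:ℝ))))) :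
    ∃ M0 : ℕ, ∀ M ≥ M0, ∃ q : ℂ → ℂ, Differentiable ℂ q ∧ ∀ t : AddCircle (1:ℝ),
      (AddCircle.toCircle t : ℂ)^M * h t = q (AddCircle.toCircle t) := by
  induction hh using Submodule.span_induction with
  | mem x hx =>
    obtain ⟨n, rfl⟩ := hx
    refine ⟨n.natAbs, fun M hM => ⟨fun z => z^((M:ℤ)+n).toNat, by fun_prop, fun t => ?_⟩⟩
    rw [fourier_apply, AddCircle.toCircle_zsmul]
    have h1 : (((M:ℤ)+n).toNat : ℤ) = (M:ℤ)+n := Int.toNat_of_nonneg (by omega)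
    change (Circle.coeHom (AddCircle.toCircle t))^M * Circle.coeHom ((AddCircle.toCircle t)^n) = (Circle.coeHom (AddCircle.toCircle t))^(((M:ℤ)+n).toNat)
    rw [← map_pow, ← map_pow, ← map_mul, ← zpow_natCast, ← zpow_natCast, h1, zpow_add]
  | zero => exact ⟨0, fun M _ => ⟨0, by fun_prop, by simp⟩⟩
  | add x y _ _ hx hy =>
    obtain ⟨M1, h1⟩ := hx
    obtain ⟨M2, h2⟩ := hy
    refine ⟨max M1 M2, fun M hM => ?_⟩
    obtain ⟨q1, d1, e1⟩ := h1 M (le_trans (le_max_left _ _) hM)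
    obtain ⟨q2, d2, e2⟩ := h2 M (le_trans (le_max_right _ _) hM)
    refine ⟨q1 + q2, d1.add d2, fun t => ?_⟩
    simp [mul_add, e1, e2]
  | smul a x _ hx =>
    obtain ⟨M1, h1⟩ := hx
    refine ⟨M1, fun M hM => ?_⟩
    obtain ⟨q1, d1, e1⟩ := h1 M hM
    refine ⟨fun z => a * q1 z, by fun_prop, fun t => ?_⟩
    simp [← e1]; ring

lemma laurent_scalar (g : ℂ → ℂ) (hg : ContinuousOn g (sphere 0 1)) {ε : ℝ} (hε : 0 < ε) :
    ∃ M0 : ℕ, ∀ M ≥ M0, ∃ q : ℂ → ℂ, Differentiable ℂ q ∧ ∀ z : ℂ, ‖z‖ = 1 →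
      ‖z^M * g z - q z‖ < ε := by
  have hc : Continuous (fun t : AddCircle (1:ℝ) => g (AddCircle.toCircle t : ℂ)) := by
    refine hg.comp_continuous ?_ ?_
    · exact continuous_subtype_val.comp AddCircle.continuous_toCircle
    · intro t; simpa using Circle.norm_coe (AddCircle.toCircle t)
  let G : C(AddCircle (1:ℝ), ℂ) := ⟨_, hc⟩
  have hG : G ∈ (Submodule.span ℂ (range (fourier (T := (1:ℝ))))).topologicalClosure := by
    rw [span_fourier_closure_eq_top]; trivial
  obtain ⟨h, hh, hd⟩ := Metric.mem_closure_iff.1 hG ε hε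
  obtain ⟨M0, hM⟩ := laurent_span h hh
  refine ⟨M0, fun M hMM => ?_⟩
  obtain ⟨q, dq, eq⟩ := hM M hMM
  refine ⟨q, dq, fun z hz => ?_⟩
  obtain ⟨t, ht⟩ : ∃ t : AddCircle (1:ℝ), (AddCircle.toCircle t : ℂ) = z := by
    obtain ⟨t, ht⟩ := (AddCircle.homeomorphCircle (T := 1) one_ne_zero).surjective ⟨z, by simp [Submonoid.unitSphere, hz]⟩
    refine ⟨t, ?_⟩
    rw [AddCircle.homeomorphCircle_apply] at ht
    rw [ht]
  have := ContinuousMap.dist_lt_iff hε |>.1 hd t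
  rw [dist_eq_norm] at this
  rw [← ht, ← eq, ← mul_sub, norm_mul, norm_pow, Circle.norm_coe, one_pow, one_mul]
  exact this

lemma laurent_vec {N : ℕ} (g : ℂ → Cn N) (hg : ContinuousOn g (sphere 0 1)) {ε : ℝ} (hε : 0 < ε) :
    ∃ M0 : ℕ, ∀ M ≥ M0, ∃ q : ℂ → Cn N, Differentiable ℂ q ∧ ∀ z : ℂ, ‖z‖ = 1 →
      ‖z^M • g z - q z‖ < ε := by
  have h1 : ∀ i : Fin N, ContinuousOn (fun z => g z i) (sphere 0 1) := fun i => by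
    have : Continuous (fun x : Cn N => x i) := by fun_prop
    exact this.comp_continuousOn hg
  have hε' : 0 < ε / (N+1) := by positivity
  choose M0 hM0 using fun i => laurent_scalar _ (h1 i) hε'
  refine ⟨Finset.univ.sup M0, fun M hM => ?_⟩
  choose q dq hq using fun i => hM0 i M (le_trans (Finset.le_sup (Finset.mem_univ i)) hM)
  refine ⟨fun z => ∑ i, q i z • EuclideanSpace.single i (1:ℂ), ?_, fun z hz => ?_⟩
  · apply Differentiable.fun_sum; intro i _; exact (dq i).smul_const _
  have h2 : z^M • g z - ∑ i, q i z • EuclideanSpace.single i (1:ℂ)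
     = ∑ i, (z^M * g z i - q i z) • EuclideanSpace.single i (1:ℂ) := by
    ext j
    simp [Finset.sum_apply, Pi.single_apply]
  rw [h2]
  calc _ ≤ ∑ i : Fin N, ‖(z^M * g z i - q i z) • (EuclideanSpace.single i (1:ℂ) : Cn N)‖ := norm_sum_le _ _
    _ ≤ ∑ i : Fin N, ε/(N+1) := by
      apply Finset.sum_le_sum; intro i _
      rw [norm_smul]; simp only [PiLp.norm_single, norm_one, mul_one]
      exact (hq i z hz).le
    _ = N * (ε/(N+1)) := by simp
    _ < ε := by
      rw [← mul_div_assoc, div_lt_iff₀ (by positivity)]; nlinarith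

/-- annulus lemma -/
lemma annulus_small (u : ℂ → ℝ) (hu : ContinuousOn u {z | 1/2 ≤ ‖z‖ ∧ ‖z‖ ≤ 1}) {ε : ℝ}
    (h : ∀ z, ‖z‖ = 1 → u z < ε) :
    ∃ r' : ℝ, r' < 1 ∧ ∀ z, r' ≤ ‖z‖ → ‖z‖ ≤ 1 → 1/2 ≤ ‖z‖ → u z < ε := by
  by_contra hcon
  push Not at hcon
  have h1 : ∀ n : ℕ, ∃ z : ℂ, 1 - 1/((n:ℝ)+1) ≤ ‖z‖ ∧ ‖z‖ ≤ 1 ∧ 1/2 ≤ ‖z‖ ∧ ε ≤ u z :=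
    fun n => hcon _ (by have : 0 < 1/((n:ℝ)+1) := by positivity
                        linarith)
  choose z hz1 hz2 hz3 hz4 using h1
  have hcpt : IsCompact {z : ℂ | 1/2 ≤ ‖z‖ ∧ ‖z‖ ≤ 1} := by
    refine (isCompact_closedBall (0:ℂ) 1).of_isClosed_subset ?_ (fun z hz => by simpa using hz.2)
    exact (isClosed_le continuous_const continuous_norm).inter (isClosed_le continuous_norm continuous_const)
  obtain ⟨a, ha, φ, hφ, hlim⟩ := hcpt.tendsto_subseq (fun n => (⟨hz3 n, hz2 n⟩ : z n ∈ {z : ℂ | 1/2 ≤ ‖z‖ ∧ ‖z‖ ≤ 1}))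
  have hn : Tendsto (fun n => ‖z (φ n)‖) atTop (nhds ‖a‖) := (continuous_norm.tendsto a).comp hlim
  have h2 : Tendsto (fun n => 1 - 1/((φ n:ℝ)+1)) atTop (nhds (1 - 0)) :=
    (tendsto_const_nhds.sub (tendsto_one_div_add_atTop_nhds_zero_nat (𝕜 := ℝ))).comp hφ.tendsto_atTop
  have ha1 : ‖a‖ = 1 := by
    apply le_antisymm ha.2
    have := le_of_tendsto_of_tendsto' h2 hn (fun n => hz1 (φ n))
    linarith
  have h3 : Tendsto (fun n => u (z (φ n))) atTop (nhds (u a)) := by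
    refine (hu a ha).tendsto.comp ?_
    exact tendsto_nhdsWithin_iff.2 ⟨hlim, Eventually.of_forall fun n => ⟨hz3 _, hz2 _⟩⟩
  have := ge_of_tendsto' h3 (fun n => hz4 (φ n))
  linarith [h a ha1]

end

noncomputable section
open Set Filter Complex Metric
open scoped ENNReal

/-- Discs with boundary in `O` (near the boundary in `Y`) can be pushed into the second set. -/
def Reach {N : ℕ} (R : ℝ) (Y O O' : Set (Cn N)) : Prop :=
  ∀ f : ℂ → Cn N, DifferentiableOn ℂ f (ball 0 R) → ∀ r : ℝ, 0 < r → r < 1 →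
    (∀ z, r ≤ ‖z‖ → ‖z‖ ≤ 1 → f z ∈ Y) → (∀ z, ‖z‖ = 1 → f z ∈ O) → ∀ ε : ℝ, 0 < ε →
    ∃ F : ℂ → Cn N, DifferentiableOn ℂ F (ball 0 R) ∧ F 0 = f 0 ∧ deriv F 0 = deriv f 0 ∧
      (∀ z, ‖z‖ ≤ r → ‖F z - f z‖ < ε) ∧ (∀ z, r ≤ ‖z‖ → ‖z‖ ≤ 1 → F z ∈ Y) ∧
      (∀ z, ‖z‖ = 1 → F z ∈ O')

lemma Reach.trans {N : ℕ} {R : ℝ} {Y O₁ O₂ O₃ : Set (Cn N)} (h₁ : Reach R Y O₁ O₂)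
    (h₂ : Reach R Y O₂ O₃) : Reach R Y O₁ O₃ := by
  intro f hf r hr hr1 hY hO ε hε
  obtain ⟨F, dF, F0, F1, hFε, hFY, hFO⟩ := h₁ f hf r hr hr1 hY hO (ε/2) (by linarith)
  obtain ⟨G, dG, G0, G1, hGε, hGY, hGO⟩ := h₂ F dF r hr hr1 hFY hFO (ε/2) (by linarith)
  refine ⟨G, dG, G0.trans F0, G1.trans F1, fun z hz => ?_, hGY, hGO⟩
  calc ‖G z - f z‖ = ‖(G z - F z) + (F z - f z)‖ := by congr 1; abel
    _ ≤ _ := norm_add_le _ _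
    _ < ε := by linarith [hGε z hz, hFε z hz]

lemma Reach.mono {N : ℕ} {R : ℝ} {Y O₁ O₂ O₁' O₂' : Set (Cn N)} (h : Reach R Y O₁ O₂)
    (h₁ : O₁' ⊆ O₁) (h₂ : O₂ ⊆ O₂') : Reach R Y O₁' O₂' := by
  intro f hf r hr hr1 hY hO ε hε
  obtain ⟨F, dF, F0, F1, hFε, hFY, hFO⟩ := h f hf r hr hr1 hY (fun z hz => h₁ (hO z hz)) ε hε
  exact ⟨F, dF, F0, F1, hFε, hFY, fun z hz => h₂ (hFO z hz)⟩

lemma Reach.refl' {N : ℕ} {R : ℝ} {Y O₁ O₂ : Set (Cn N)} (h : O₁ ⊆ O₂) : Reach R Y O₁ O₂ := by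
  intro f hf r hr hr1 hY hO ε hε
  exact ⟨f, hf, rfl, rfl, fun z _ => by simpa using hε, hY, fun z hz => h (hO z hz)⟩

lemma isCompact_circle_image {N : ℕ} {R : ℝ} (hR : 1 < R) {f : ℂ → Cn N}
    (hf : DifferentiableOn ℂ f (ball 0 R)) : IsCompact (f '' {z | ‖z‖ = 1}) := by
  have : {z : ℂ | ‖z‖ = 1} = sphere 0 1 := by ext; simp
  rw [this]
  refine (isCompact_sphere (0:ℂ) 1).image_of_continuousOn (hf.continuousOn.mono ?_)
  intro z hz
  simp at hz ⊢
  linarith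

/-- open sets exhausted by sublevel type condition: monotone union -/
lemma Reach.of_levels {N : ℕ} {R : ℝ} (hR : 1 < R) {Y O O' : Set (Cn N)} (φ : Cn N → ℝ) (a : ℝ)
    (hφ : ContinuousOn φ O) (ha : ∀ x ∈ O, a < φ x)
    (h : ∀ θ > a, Reach R Y {x ∈ O | θ < φ x} O') : Reach R Y O O' := by
  intro f hf r hr hr1 hY hO ε hε
  have hK := isCompact_circle_image hR hf
  have hsub : f '' {z | ‖z‖ = 1} ⊆ O := by rintro _ ⟨z, hz, rfl⟩; exact hO z hz
  obtain ⟨x0, hx0, hmin⟩ := hK.exists_isMinOn ⟨f 1, 1, by simp, rfl⟩ (hφ.mono hsub)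
  have h0 := ha x0 (hsub hx0)
  refine h ((a + φ x0)/2) (by linarith) f hf r hr hr1 hY (fun z hz => ⟨hO z hz, ?_⟩) ε hε
  have := hmin (mem_image_of_mem f (show z ∈ {z : ℂ | ‖z‖ = 1} from hz))
  simp only [mem_ofPred_eq] at this
  linarith

lemma push_lemma {N : ℕ} {R : ℝ} (hR : 1 < R) {Y O O' : Set (Cn N)} (hY : IsOpen Y) (hO' : IsOpen O')
    (A B : Cn N → Cn N) (hA : Continuous A) (hB : Continuous B)
    (h1 : ∀ x ∈ O, ∀ η : ℂ, ‖η‖ ≤ 1 → x + η • A x + η^2 • B x ∈ Y)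
    (h2 : ∀ x ∈ O, ∀ η : ℂ, ‖η‖ = 1 → x + η • A x + η^2 • B x ∈ O') : Reach R Y O O' := by
  intro f hf r hr hr1 hfY hfO ε hε
  have hfc : ContinuousOn f (closedBall 0 1) := hf.continuousOn.mono (closedBall_subset_ball hR)
  have hcS : IsCompact {z : ℂ | ‖z‖ = 1} := by
    have : {z : ℂ | ‖z‖ = 1} = sphere 0 1 := by ext; simp
    rw [this]; exact isCompact_sphere _ _
  have hcB : IsCompact {z : ℂ | ‖z‖ ≤ 1} := by
    have : {z : ℂ | ‖z‖ ≤ 1} = closedBall 0 1 := by ext; simp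
    rw [this]; exact isCompact_closedBall _ _
  have hcK := isCompact_circle_image hR hf
  let Ψ : Cn N × ℂ → Cn N := fun p => p.1 + p.2 • A p.1 + p.2^2 • B p.1
  have hΨ : Continuous Ψ := by fun_prop
  have hK1 := (hcK.prod hcB).image hΨ
  have hK2 := (hcK.prod hcS).image hΨ
  have hsub1 : Ψ '' ((f '' {z | ‖z‖ = 1}) ×ˢ {z : ℂ | ‖z‖ ≤ 1}) ⊆ Y := by
    rintro _ ⟨⟨x, η⟩, ⟨⟨z, hz, rfl⟩, hη⟩, rfl⟩
    exact h1 _ (hfO z hz) η hη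
  have hsub2 : Ψ '' ((f '' {z | ‖z‖ = 1}) ×ˢ {z : ℂ | ‖z‖ = 1}) ⊆ O' := by
    rintro _ ⟨⟨x, η⟩, ⟨⟨z, hz, rfl⟩, hη⟩, rfl⟩
    exact h2 _ (hfO z hz) η hη
  have hcA : IsCompact {z : ℂ | r ≤ ‖z‖ ∧ ‖z‖ ≤ 1} := by
    refine hcB.of_isClosed_subset ?_ (fun z hz => hz.2)
    exact (isClosed_le continuous_const continuous_norm).inter (isClosed_le continuous_norm continuous_const)
  have hK3 : IsCompact (f '' {z : ℂ | r ≤ ‖z‖ ∧ ‖z‖ ≤ 1}) :=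
    hcA.image_of_continuousOn (hfc.mono (fun z hz => by simpa using hz.2))
  have hsub3 : f '' {z : ℂ | r ≤ ‖z‖ ∧ ‖z‖ ≤ 1} ⊆ Y := by
    rintro _ ⟨z, hz, rfl⟩; exact hfY z hz.1 hz.2
  obtain ⟨δ1, hδ1, ht1⟩ := hK1.exists_thickening_subset_open hY hsub1
  obtain ⟨δ2, hδ2, ht2⟩ := hK2.exists_thickening_subset_open hO' hsub2
  obtain ⟨δ3, hδ3, ht3⟩ := hK3.exists_thickening_subset_open hY hsub3
  obtain ⟨δ, hδ, hd1, hd2, hd3, hd4⟩ : ∃ δ > 0, δ ≤ δ1 ∧ δ ≤ δ2 ∧ δ ≤ δ3 ∧ δ ≤ ε :=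
    ⟨min (min δ1 δ2) (min δ3 ε), by positivity, by simp, by simp, by simp, by simp⟩
  -- Laurent
  have hfcs : ContinuousOn f (sphere 0 1) := hfc.mono sphere_subset_closedBall
  obtain ⟨MA, hMA⟩ := laurent_vec (fun z => A (f z)) (hA.comp_continuousOn hfcs) (ε := δ/4) (by positivity)
  obtain ⟨MB, hMB⟩ := laurent_vec (fun z => B (f z)) (hB.comp_continuousOn hfcs) (ε := δ/4) (by positivity)
  obtain ⟨qA, dqA, hqA⟩ := hMA (max MA MB) (le_max_left _ _)
  obtain ⟨qB, dqB, hqB⟩ := hMB (max MA MB) (le_max_right _ _)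
  set M := max MA MB
  let ζ : ℂ → ℂ := fun z => ((‖z‖⁻¹ : ℝ) : ℂ) * z
  have hζn : ∀ z : ℂ, 1/2 ≤ ‖z‖ → ‖ζ z‖ = 1 := by
    intro z hz
    simp only [ζ, norm_mul, Complex.norm_real, norm_inv, norm_norm]
    exact inv_mul_cancel₀ (by linarith)
  have hζ1 : ∀ z : ℂ, ‖z‖ = 1 → ζ z = z := by
    intro z hz; simp [ζ, hz]
  have hζc : ContinuousOn ζ {z | 1/2 ≤ ‖z‖ ∧ ‖z‖ ≤ 1} := by
    refine ContinuousOn.mul ?_ continuousOn_id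
    refine Complex.continuous_ofReal.comp_continuousOn ?_
    exact continuous_norm.continuousOn.inv₀ (fun z hz => by have := hz.1; intro h; linarith)
  let u : ℂ → ℝ := fun z => ‖f z - f (ζ z)‖ + ‖z^M • A (f (ζ z)) - qA z‖ + ‖z^M • B (f (ζ z)) - qB z‖
  have hfζ : ContinuousOn (fun z => f (ζ z)) {z | 1/2 ≤ ‖z‖ ∧ ‖z‖ ≤ 1} :=
    hfc.comp hζc (fun z hz => by simp [hζn z hz.1])
  have hu : ContinuousOn u {z | 1/2 ≤ ‖z‖ ∧ ‖z‖ ≤ 1} := by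
    have e1 := hfc.mono (fun z (hz : z ∈ {z : ℂ | 1/2 ≤ ‖z‖ ∧ ‖z‖ ≤ 1}) => (by simpa using hz.2 : z ∈ closedBall (0:ℂ) 1))
    have e2 := hA.comp_continuousOn hfζ
    have e3 := hB.comp_continuousOn hfζ
    have e4 := dqA.continuous.continuousOn (s := {z | 1/2 ≤ ‖z‖ ∧ ‖z‖ ≤ 1})
    have e5 := dqB.continuous.continuousOn (s := {z | 1/2 ≤ ‖z‖ ∧ ‖z‖ ≤ 1})
    have e6 : ContinuousOn (fun z : ℂ => z^M) {z | 1/2 ≤ ‖z‖ ∧ ‖z‖ ≤ 1} := by fun_prop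
    exact ((e1.sub hfζ).norm.add ((e6.smul e2).sub e4).norm).add ((e6.smul e3).sub e5).norm
  have hu1 : ∀ z, ‖z‖ = 1 → u z < δ := by
    intro z hz
    simp only [u, hζ1 z hz, sub_self, norm_zero]
    linarith [hqA z hz, hqB z hz]
  obtain ⟨r0, hr0, hur0⟩ := annulus_small u hu hu1
  obtain ⟨r', hr'1, hr'0, hr'r, hr'h⟩ : ∃ r' < 1, r0 ≤ r' ∧ r ≤ r' ∧ 1/2 ≤ r' :=
    ⟨max (max r0 r) (1/2), by simp [hr0, hr1]; norm_num, by simp, by simp, by simp⟩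
  -- bounds
  have hcB' := isCompact_closedBall (0:ℂ) 1
  obtain ⟨CA, hCA⟩ := hcB'.exists_bound_of_continuousOn dqA.continuous.continuousOn
  obtain ⟨CB, hCB⟩ := hcB'.exists_bound_of_continuousOn dqB.continuous.continuousOn
  have hCA0 : 0 ≤ CA := (norm_nonneg _).trans (hCA 0 (by simp))
  have hCB0 : 0 ≤ CB := (norm_nonneg _).trans (hCB 0 (by simp))
  have hr'pos : 0 < r' := by linarith
  obtain ⟨m, hm2, hm⟩ : ∃ m : ℕ, 2 ≤ m ∧ r'^m * (CA + CB) < δ := by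
    have h : Tendsto (fun m : ℕ => r'^m * (CA + CB)) atTop (nhds (0 * (CA+CB))) :=
      (tendsto_pow_atTop_nhds_zero_of_lt_one hr'pos.le hr'1).mul_const _
    rw [zero_mul] at h
    have := (h.eventually_lt_const hδ).and (eventually_ge_atTop 2)
    obtain ⟨m, h1, h2⟩ := this.exists
    exact ⟨m, h2, h1⟩
  let F : ℂ → Cn N := fun z => f z + (z^m • qA z + z^(M+2*m) • qB z)
  have hFr' : ∀ z, ‖z‖ ≤ r' → ‖F z - f z‖ < δ := by
    intro z hz
    have hz1 : ‖z‖ ≤ 1 := hz.trans hr'1.le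
    have : F z - f z = z^m • qA z + z^(M+2*m) • qB z := by simp [F]
    rw [this]
    refine lt_of_le_of_lt (norm_add_le _ _) (lt_of_le_of_lt ?_ hm)
    rw [norm_smul, norm_smul, norm_pow, norm_pow, mul_add]
    have hp : ‖z‖^m ≤ r'^m := pow_le_pow_left₀ (norm_nonneg _) hz m
    have hp2 : ‖z‖^(M+2*m) ≤ r'^m := 
      (pow_le_pow_of_le_one (norm_nonneg _) hz1 (by omega)).trans hp
    have a1 := hCA z (by simpa using hz1)
    have a2 := hCB z (by simpa using hz1)
    gcongr
  have hFann : ∀ z, r' ≤ ‖z‖ → ‖z‖ ≤ 1 →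
      dist (F z) (Ψ (f (ζ z), z^(M+m))) < δ := by
    intro z hz hz1
    have hz2 : 1/2 ≤ ‖z‖ := by linarith
    have huz := hur0 z (hr'0.trans hz) hz1 hz2
    refine lt_of_le_of_lt ?_ huz
    rw [dist_eq_norm]
    have e : F z - Ψ (f (ζ z), z^(M+m)) = (f z - f (ζ z)) + (-(z^m • (z^M • A (f (ζ z)) - qA z)))
        + (-(z^(M+2*m) • (z^M • B (f (ζ z)) - qB z))) := by
      simp only [F, Ψ, smul_sub, smul_smul]
      have : (z^(M+m))^2 = z^(M+2*m) * z^M := by ring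
      have h' : z^(M+m) = z^m * z^M := by ring
      rw [this, h']
      abel
    rw [e]
    refine (norm_add₃_le).trans ?_
    simp only [u, norm_neg, norm_smul, norm_pow]
    have hp : ‖z‖^m ≤ 1 := pow_le_one₀ (norm_nonneg _) hz1
    have hp2 : ‖z‖^(M+2*m) ≤ 1 := pow_le_one₀ (norm_nonneg _) hz1
    have n1 := norm_nonneg (z^M • A (f (ζ z)) - qA z)
    have n2 := norm_nonneg (z^M • B (f (ζ z)) - qB z)
    nlinarith
  have hdf : DifferentiableAt ℂ f 0 := hf.differentiableAt (ball_mem_nhds _ (by linarith))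
  refine ⟨F, ?_, ?_, ?_, fun z hz => (hFr' z (hz.trans hr'r)).trans_le hd4, ?_, ?_⟩
  · refine hf.add (Differentiable.differentiableOn ?_)
    fun_prop
  · have : m ≠ 0 := by omega
    simp [F, this]
  · have : HasDerivAt (fun z => z^m • qA z + z^(M+2*m) • qB z) 0 0 := by
      have e1 := (hasDerivAt_pow m (0:ℂ)).smul (dqA 0).hasDerivAt
      have e2 := (hasDerivAt_pow (M+2*m) (0:ℂ)).smul (dqB 0).hasDerivAt
      have e3 := e1.add e2
      have z1 : m ≠ 0 := by omega
      have z2 : m - 1 ≠ 0 := by omega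
      have z3 : M + 2*m ≠ 0 := by omega
      have z4 : M + 2*m - 1 ≠ 0 := by omega
      simp only [ne_eq, z1, z2, z3, z4, not_false_eq_true, zero_pow, zero_smul, mul_zero, add_zero] at e3
      exact e3
    have := (hdf.hasDerivAt.add this).deriv
    rw [add_zero] at this
    exact this
  · intro z hz hz1
    rcases le_total ‖z‖ r' with h | h
    · refine ht3 (mem_thickening_iff.2 ⟨f z, ⟨z, ⟨hz, hz1⟩, rfl⟩, ?_⟩)
      rw [dist_eq_norm]; exact (hFr' z h).trans_le hd3
    · refine ht1 (mem_thickening_iff.2 ⟨_, ⟨(f (ζ z), z^(M+m)), ⟨⟨ζ z, hζn z (by linarith), rfl⟩, ?_⟩, rfl⟩,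
        (hFann z h hz1).trans_le hd1⟩)
      simp only [mem_ofPred_eq, norm_pow]
      exact pow_le_one₀ (norm_nonneg _) hz1
  · intro z hz
    refine ht2 (mem_thickening_iff.2 ⟨_, ⟨(f (ζ z), z^(M+m)), ⟨⟨ζ z, hζn z (by rw [hz]; norm_num), rfl⟩, ?_⟩, rfl⟩,
        (hFann z (by rw [hz]; exact hr'1.le) hz.le).trans_le hd2⟩)
    simp [hz]

end

noncomputable section
open Set Filter Complex Metric
open scoped ENNReal

lemma levi_eq {N : ℕ} (ρ : Cn N → ℝ) (x v : Cn N) : LeviForm ρ x v =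
    (1/4) * (fderiv ℝ (fderiv ℝ ρ) x v v + fderiv ℝ (fderiv ℝ ρ) x (I • v) (I • v)) := by
  simp [LeviForm, iteratedFDeriv_two_apply]

/-- complexification of a real linear functional -/
def lc {N : ℕ} (D : Cn N →L[ℝ] ℝ) : Cn N →ₗ[ℂ] ℂ where
  toFun v := (D v : ℂ) - I * (D (I • v) : ℂ)
  map_add' v w := by simp; ring
  map_smul' c v := by
    have h1 : c • v = c.re • v + c.im • (I • v) := by
      conv_lhs => rw [← Complex.re_add_im c]
      rw [add_smul, mul_smul]; rfl
    have h2 : I • (c • v) = c.re • (I • v) - c.im • v := by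
      rw [h1, smul_add, smul_comm I c.re, smul_comm I c.im, smul_smul I I, I_mul_I, neg_one_smul]
      simp [sub_eq_add_neg]
    rw [h2, h1]
    simp only [map_add, map_sub, map_smul, smul_eq_mul, RingHom.id_apply]
    apply Complex.ext <;> simp <;> ring

lemma lc_apply {N : ℕ} (D : Cn N →L[ℝ] ℝ) (v : Cn N) : lc D v = (D v : ℂ) - I * (D (I • v) : ℂ) := rfl

lemma lc_re {N : ℕ} (D : Cn N →L[ℝ] ℝ) (v : Cn N) : (lc D v).re = D v := by
  simp [lc_apply]

lemma cn_smul_eq {N : ℕ} (c : ℂ) (v : Cn N) : c • v = c.re • v + c.im • (I • v) := by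
  conv_lhs => rw [← Complex.re_add_im c]
  rw [add_smul, mul_smul]; rfl

/-- the (2,0)-part -/
def q20 {N : ℕ} (H : Cn N →L[ℝ] Cn N →L[ℝ] ℝ) (e : Cn N) : ℂ :=
  ((1/4 * (H e e - H (I • e) (I • e)) : ℝ) : ℂ) - (I/2) * (H e (I • e) : ℝ)

lemma half_hess {N : ℕ} (H : Cn N →L[ℝ] Cn N →L[ℝ] ℝ) (hs : ∀ v w, H v w = H w v) (e : Cn N) (ν : ℂ) :
    1/2 * H (ν • e) (ν • e) = (ν^2 * q20 H e).re + ‖ν‖^2 * (1/4 * (H e e + H (I • e) (I • e))) := by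
  rw [cn_smul_eq ν e]
  simp only [map_add, map_smul, add_apply, smul_apply, smul_eq_mul]
  rw [hs (I • e) e, ← Complex.normSq_eq_norm_sq, Complex.normSq_apply, q20]
  simp [pow_two]
  ring

/-- second order Taylor estimate -/
lemma taylor2 {E : Type*} [NormedAddCommGroup E] [NormedSpace ℝ E] (φ : E → ℝ) (x0 : E) (R ε : ℝ)
    (hφ : ContDiffOn ℝ 2 φ (ball x0 R)) (x w : E) (hx : x ∈ ball x0 R) (hxw : x + w ∈ ball x0 R)
    (hH : ∀ y ∈ ball x0 R, ‖fderiv ℝ (fderiv ℝ φ) y - fderiv ℝ (fderiv ℝ φ) x‖ ≤ ε) :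
    |φ (x + w) - φ x - fderiv ℝ φ x w - 1/2 * fderiv ℝ (fderiv ℝ φ) x w w| ≤ ε * ‖w‖^2 := by
  set D := fderiv ℝ φ
  set H := fderiv ℝ D
  have hφa : ∀ y ∈ ball x0 R, ContDiffAt ℝ 2 φ y := fun y hy => hφ.contDiffAt (isOpen_ball.mem_nhds hy)
  have hsym : ∀ v w, H x v w = H x w v := by
    have := (hφa x hx).isSymmSndFDerivAt (by simp)
    exact fun v w => this v w
  have hdD : ∀ y ∈ ball x0 R, HasFDerivAt D (H y) y := by
    intro y hy
    have : ContDiffAt ℝ 1 D y := (hφa y hy).fderiv_right (by norm_num)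
    exact (this.differentiableAt (by norm_num)).hasFDerivAt
  have hd : ∀ y ∈ ball x0 R, HasFDerivAt φ (D y) y := fun y hy =>
    ((hφa y hy).differentiableAt (by norm_num)).hasFDerivAt
  have hε : 0 ≤ ε := by
    exact (ContinuousLinearMap.opNorm_nonneg (H x - H x)).trans (hH x hx)
  have h1 : ∀ y ∈ ball x0 R, ‖D y - D x - H x (y - x)‖ ≤ ε * ‖y - x‖ := by
    intro y hy
    exact (convex_ball x0 R).norm_image_sub_le_of_norm_hasFDerivWithin_le'
      (fun z hz => (hdD z hz).hasFDerivWithinAt) (fun z hz => hH z hz) hx hy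
  let ψ : E → ℝ := fun y => φ y - 1/2 * H x (y - x) (y - x)
  have hψ : ∀ y ∈ ball x0 R, HasFDerivAt ψ (D y - H x (y - x)) y := by
    intro y hy
    have e1 : HasFDerivAt (fun y => y - x) (ContinuousLinearMap.id ℝ E) y := (hasFDerivAt_id y).sub_const x
    have e2 : HasFDerivAt (fun y => H x (y - x)) (H x) y := by
      exact ((H x).hasFDerivAt (x := y - x)).comp y e1
    have e3 := (hd y hy).sub ((e2.clm_apply e1).const_mul (1/2))
    refine e3.congr_fderiv ?_
    ext v
    have hv := hsym v (y - x)
    simp only [sub_apply, smul_apply, add_apply, ContinuousLinearMap.comp_apply, ContinuousLinearMap.id_apply,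
      ContinuousLinearMap.flip_apply, smul_eq_mul, hv]
    ring
  set S := ball x0 R ∩ closedBall x ‖w‖
  have hS : Convex ℝ S := (convex_ball _ _).inter (convex_closedBall _ _)
  have h2 := hS.norm_image_sub_le_of_norm_hasFDerivWithin_le' (f := ψ) (φ := D x) (C := ε * ‖w‖)
    (fun z hz => (hψ z hz.1).hasFDerivWithinAt) (fun z hz => by
      have := h1 z hz.1
      have hz2 : ‖z - x‖ ≤ ‖w‖ := by have := hz.2; rwa [mem_closedBall, dist_eq_norm] at this
      have e : D z - H x (z - x) - D x = D z - D x - H x (z - x) := by abel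
      rw [e]
      exact this.trans (mul_le_mul_of_nonneg_left hz2 hε)) 
    (⟨hx, by simp⟩ : x ∈ S) (⟨hxw, by simp⟩ : x + w ∈ S)
  simp only [ψ, add_sub_cancel_left, sub_self, map_zero, mul_zero, sub_zero, Real.norm_eq_abs] at h2
  calc _ = |φ (x + w) - 1/2 * H x w w - φ x - D x w| := by congr 1; ring
    _ ≤ _ := h2
    _ = _ := by ring

end

noncomputable section
open Set Filter Complex Metric
open scoped ENNReal Topology

lemma cn_ofReal_smul {N : ℕ} (a : ℝ) (v : Cn N) : ((a : ℂ)) • v = a • v := by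
  rfl

lemma cont_eH {N : ℕ} (H : Cn N → Cn N →L[ℝ] Cn N →L[ℝ] ℝ) (e : Cn N → Cn N) (x : Cn N)
    (hH : ContinuousAt H x) (he : ContinuousAt e x) (c d : ℂ) :
    ContinuousAt (fun x => H x (c • e x) (d • e x)) x := by
  have h1 : ContinuousAt (fun x => c • e x) x := he.const_smul c
  have h2 : ContinuousAt (fun x => d • e x) x := he.const_smul d
  have h3 : ContinuousAt (fun x => H x (c • e x)) x := hH.clm_apply h1
  exact h3.clm_apply h2

lemma clm2_norm_cont {N : ℕ} (H : Cn N → Cn N →L[ℝ] Cn N →L[ℝ] ℝ) (x : Cn N)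
    (hH : ContinuousAt H x) : ContinuousAt (fun x => ‖H x‖) x := by
  have : Continuous (fun A : Cn N →L[ℝ] Cn N →L[ℝ] ℝ => ‖A‖) := @continuous_norm (Cn N →L[ℝ] Cn N →L[ℝ] ℝ) _
  exact this.continuousAt.comp hH

set_option maxHeartbeats 1000000 in
lemma lp_data {N : ℕ} (φ : Cn N → ℝ) (x0 : Cn N) (hφ : ContDiffAt ℝ 2 φ x0)
    (hd : fderiv ℝ φ x0 ≠ 0) (hT : TwoPosEigen φ x0) (U : Set (Cn N)) (hU : U ∈ 𝓝 x0) :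
    ∃ r1 > 0, ball x0 r1 ⊆ U ∧ ∃ e b : Cn N → Cn N, ContinuousOn e (ball x0 r1) ∧ ContinuousOn b (ball x0 r1) ∧
    ∃ C > 0, (∀ x ∈ ball x0 r1, ‖e x‖ ≤ C ∧ ‖b x‖ ≤ C) ∧ ∃ m > 0, ∃ t0 > 0, ∀ x ∈ ball x0 r1, ∀ ν : ℂ, ‖ν‖ ≤ t0 →
      x + ν • e x + ν^2 • b x ∈ ball x0 r1 →
      φ x + m * ‖ν‖^2 ≤ φ (x + ν • e x + ν^2 • b x) := by
  obtain ⟨W, hW2, hWpos⟩ := hT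
  set D := fderiv ℝ φ with hD
  set H := fderiv ℝ D with hH
  obtain ⟨u, hu⟩ : ∃ u, D x0 u ≠ 0 := by
    by_contra hcon; push Not at hcon; exact hd (by ext v; simpa using hcon v)
  have hlu : lc (D x0) u ≠ 0 := by
    intro h; apply hu; rw [← lc_re, h]; simp
  obtain ⟨e0, he0W, he0, hle0⟩ : ∃ e0 ∈ W, e0 ≠ 0 ∧ lc (D x0) e0 = 0 := by
    have hker : LinearMap.ker ((lc (D x0)).domRestrict W) ≠ ⊥ := by
      apply LinearMap.ker_ne_bot_of_finrank_lt
      rw [hW2]; simp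
    obtain ⟨w, hw, hw0⟩ := Submodule.exists_mem_ne_zero_of_ne_bot hker
    exact ⟨w, w.2, by simpa using hw0, by simpa using hw⟩
  -- continuity near x0
  have hev : ∀ᶠ x in 𝓝 x0, ContDiffAt ℝ 2 φ x := hφ.eventually (by simp)
  have hDc : ∀ x, ContDiffAt ℝ 2 φ x → ContinuousAt D x := fun x hx =>
    (hx.fderiv_right (m := 1) (by norm_num)).continuousAt
  have hHc : ∀ x, ContDiffAt ℝ 2 φ x → ContinuousAt H x := fun x hx =>
    ((hx.fderiv_right (m := 1) (by norm_num)).fderiv_right (m := 0) (by norm_num)).continuousAt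
  let l : Cn N → Cn N → ℂ := fun x v => lc (D x) v
  have hlc : ∀ x, ContDiffAt ℝ 2 φ x → ∀ v, ContinuousAt (fun x => lc (D x) v) x := by
    intro x hx v
    have h1 : ∀ v, ContinuousAt (fun x => D x v) x := fun v => (hDc x hx).clm_apply continuousAt_const
    simp only [lc_apply]
    exact (Complex.continuous_ofReal.continuousAt.comp (h1 v)).sub
      (continuousAt_const.mul (Complex.continuous_ofReal.continuousAt.comp (h1 (I • v))))
  let e : Cn N → Cn N := fun x => e0 - (lc (D x) e0 / lc (D x) u) • u
  let b : Cn N → Cn N := fun x => -(q20 (H x) (e x) / lc (D x) u) • u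
  have hec : ∀ x, ContDiffAt ℝ 2 φ x → lc (D x) u ≠ 0 → ContinuousAt e x := by
    intro x hx h
    exact continuousAt_const.sub (((hlc x hx e0).div (hlc x hx u) h).smul continuousAt_const)
  have hHe : ∀ x, ContDiffAt ℝ 2 φ x → lc (D x) u ≠ 0 → ∀ c d : ℂ, ContinuousAt (fun x => H x (c • e x) (d • e x)) x := by
    intro x hx h c d
    exact cont_eH H e x (hHc x hx) (hec x hx h) c d
  have hbc : ∀ x, ContDiffAt ℝ 2 φ x → lc (D x) u ≠ 0 → ContinuousAt b x := by
    intro x hx h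
    have hq : ContinuousAt (fun x => q20 (H x) (e x)) x := by
      have a1 := hHe x hx h 1 1
      have a2 := hHe x hx h I I
      have a3 := hHe x hx h 1 I
      simp only [one_smul] at a1 a3
      simp only [q20]
      exact (Complex.continuous_ofReal.continuousAt.comp (continuousAt_const.mul (a1.sub a2))).sub
        (continuousAt_const.mul (Complex.continuous_ofReal.continuousAt.comp a3))
    exact ((hq.div (hlc x hx u) h).neg).smul continuousAt_const
  have he00 : e x0 = e0 := by simp [e, hle0]
  have hlev : 0 < LeviForm φ x0 (e x0) := by rw [he00]; exact hWpos e0 he0W he0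
  let Lv : Cn N → ℝ := fun x => LeviForm φ x (e x)
  have hLvc : ContinuousAt Lv x0 := by
    have a1 := hHe x0 hφ hlu 1 1
    have a2 := hHe x0 hφ hlu I I
    simp only [one_smul] at a1
    have := (continuousAt_const (y := (1/4:ℝ))).mul (a1.add a2)
    refine this.congr (Eventually.of_forall fun x => ?_)
    simp only [Lv, levi_eq]; rfl
  set m := Lv x0 / 4 with hm
  have hm0 : 0 < m := by simp only [hm]; exact div_pos hlev (by norm_num)
  set C := ‖e x0‖ + ‖b x0‖ + 1 with hC
  have hC0 : 0 < C := by positivity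
  set K := ‖H x0‖ + 1 with hK
  have hK0 : 0 < K := by positivity
  -- eps
  set ε := m / (4 * C^2) with hεd
  have hε0 : 0 < ε := by positivity
  have E1 : ∀ᶠ x in 𝓝 x0, ‖H x - H x0‖ < ε/2 := by
    have := clm2_norm_cont (fun x => H x - H x0) x0 ((hHc x0 hφ).sub (continuousAt_const (y := H x0)))
    have h0 : ‖H x0 - H x0‖ < ε/2 := by rw [sub_self, @norm_zero (Cn N →L[ℝ] Cn N →L[ℝ] ℝ) _]; positivity
    exact this.eventually_lt_const h0
  have E2 : ∀ᶠ x in 𝓝 x0, lc (D x) u ≠ 0 := (hlc x0 hφ u).eventually_ne hlu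
  have E3 : ∀ᶠ x in 𝓝 x0, ‖e x‖ < C := (hec x0 hφ hlu).norm.eventually_lt_const (by have := norm_nonneg (b x0); linarith)
  have E4 : ∀ᶠ x in 𝓝 x0, ‖b x‖ < C := (hbc x0 hφ hlu).norm.eventually_lt_const (by have := norm_nonneg (e x0); linarith)
  have E5 : ∀ᶠ x in 𝓝 x0, 2 * m < Lv x := hLvc.eventually_const_lt (by simp only [hm]; linarith [hlev])
  have E6 : ∀ᶠ x in 𝓝 x0, ‖H x‖ < K := Tendsto.eventually_lt_const (by linarith) (clm2_norm_cont H x0 (hHc x0 hφ))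
  have Eall := ((((((hev.and E1).and E2).and E3).and E4).and E5).and E6).and hU
  obtain ⟨r1, hr1, hball⟩ := Metric.eventually_nhds_iff_ball.1 Eall
  refine ⟨r1, hr1, fun x hx => (hball x hx).2, e, b, ?_, ?_, C, hC0, ?_, m/4, by positivity,
    min 1 (m / (8 * K * C^2)), by positivity, ?_⟩
  · intro x hx
    obtain ⟨⟨⟨⟨⟨⟨⟨h1, h2⟩, h3⟩, h4⟩, h5⟩, h6⟩, h7⟩, h8⟩ := hball x hx
    exact (hec x h1 h3).continuousWithinAt
  · intro x hx
    obtain ⟨⟨⟨⟨⟨⟨⟨h1, h2⟩, h3⟩, h4⟩, h5⟩, h6⟩, h7⟩, h8⟩ := hball x hx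
    exact (hbc x h1 h3).continuousWithinAt
  · intro x hx
    obtain ⟨⟨⟨⟨⟨⟨⟨h1, h2⟩, h3⟩, h4⟩, h5⟩, h6⟩, h7⟩, h8⟩ := hball x hx
    exact ⟨h4.le, h5.le⟩
  · intro x hx ν hν hy
    obtain ⟨⟨⟨⟨⟨⟨⟨h1, h2⟩, h3⟩, h4⟩, h5⟩, h6⟩, h7⟩, h8⟩ := hball x hx
    have hν1 : ‖ν‖ ≤ 1 := hν.trans (min_le_left _ _)
    have hν2 : ‖ν‖ ≤ m / (8 * K * C^2) := hν.trans (min_le_right _ _)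
    set w := ν • e x + ν^2 • b x with hw
    rw [add_assoc, ← hw] at hy ⊢
    have hT := taylor2 φ x0 r1 ε (fun y hy => (hball y hy).1.1.1.1.1.1.1.contDiffWithinAt) x w hx hy
      (fun y hy => by
        have k1 := (hball y hy).1.1.1.1.1.1.2
        have : H y - H x = (H y - H x0) - (H x - H x0) := by abel
        change ‖H y - H x‖ ≤ ε
        rw [this]
        refine (norm_sub_le (H y - H x0) (H x - H x0)).trans ?_
        linarith)
    change |φ (x + w) - φ x - D x w - 1/2 * H x w w| ≤ ε * ‖w‖^2 at hT
    have hsym : ∀ v w, H x v w = H x w v := by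
      have := h1.isSymmSndFDerivAt (by simp)
      exact fun v w => this v w
    have hn0 := norm_nonneg ν
    have hwn : ‖w‖ ≤ 2 * C * ‖ν‖ := by
      refine (norm_add_le _ _).trans ?_
      rw [norm_smul, norm_smul, norm_pow]
      have : ‖ν‖^2 ≤ ‖ν‖ := by rw [pow_two]; exact mul_le_of_le_one_left hn0 (by linarith)
      have k1 : ‖ν‖ * ‖e x‖ ≤ ‖ν‖ * C := mul_le_mul_of_nonneg_left h4.le hn0
      have k2 : ‖ν‖^2 * ‖b x‖ ≤ ‖ν‖ * C := mul_le_mul this h5.le (norm_nonneg _) hn0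
      linarith
    have hDw : D x w = -(ν^2 * q20 (H x) (e x)).re := by
      rw [← lc_re]
      have k1 : lc (D x) (e x) = 0 := by
        simp only [e, map_sub, map_smul, smul_eq_mul]
        field_simp; ring
      have k2 : lc (D x) (b x) = - q20 (H x) (e x) := by
        simp only [b, map_smul, smul_eq_mul]
        field_simp
      rw [hw, map_add, map_smul, map_smul, k1, k2]
      simp
    have hHw : H x w w = H x (ν • e x) (ν • e x) + 2 * H x (ν • e x) (ν^2 • b x) + H x (ν^2 • b x) (ν^2 • b x) := by
      rw [hw]
      simp only [map_add, add_apply]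
      rw [hsym (ν^2 • b x) (ν • e x)]; ring
    have hb : ∀ v w, |H x v w| ≤ K * ‖v‖ * ‖w‖ := by
      intro v w
      have := (H x).le_opNorm₂ v w
      rw [Real.norm_eq_abs] at this
      refine this.trans ?_
      gcongr
    have hhh := half_hess (H x) hsym (e x) ν
    have hLx : LeviForm φ x (e x) = 1/4 * (H x (e x) (e x) + H x (I • e x) (I • e x)) := levi_eq _ _ _
    rw [← hLx] at hhh
    have h6' : 2 * m < LeviForm φ x (e x) := h6
    have b1 := hb (ν • e x) (ν^2 • b x)
    have b2 := hb (ν^2 • b x) (ν^2 • b x)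
    have n1 : ‖ν • e x‖ ≤ ‖ν‖ * C := by rw [norm_smul]; gcongr
    have n2 : ‖ν^2 • b x‖ ≤ ‖ν‖^2 * C := by rw [norm_smul, norm_pow]; gcongr
    have b1' : |H x (ν • e x) (ν^2 • b x)| ≤ K * (‖ν‖ * C) * (‖ν‖^2 * C) := b1.trans (by gcongr)
    have b2' : |H x (ν^2 • b x) (ν^2 • b x)| ≤ K * (‖ν‖^2 * C) * (‖ν‖^2 * C) := b2.trans (by gcongr)
    have hKC : ‖ν‖ * (K * C^2) ≤ m / 8 := by
      rw [le_div_iff₀ (by positivity)] at hν2 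
      linarith
    have hm3 : K * (‖ν‖ * C) * (‖ν‖^2 * C) ≤ m/8 * ‖ν‖^2 := by
      have : K * (‖ν‖ * C) * (‖ν‖^2 * C) = (‖ν‖ * (K * C^2)) * ‖ν‖^2 := by ring
      rw [this]; gcongr
    have hm4 : K * (‖ν‖^2 * C) * (‖ν‖^2 * C) ≤ m/8 * ‖ν‖^2 := by
      refine le_trans ?_ hm3
      have : K * (‖ν‖^2 * C) * (‖ν‖^2 * C) = ‖ν‖ * (K * (‖ν‖ * C) * (‖ν‖^2 * C)) := by ring
      rw [this]
      have : 0 ≤ K * (‖ν‖ * C) * (‖ν‖^2 * C) := by positivity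
      exact mul_le_of_le_one_left this hν1
    have hew : ε * ‖w‖^2 ≤ m * ‖ν‖^2 := by
      have : ‖w‖^2 ≤ (2 * C * ‖ν‖)^2 := by gcongr
      calc ε * ‖w‖^2 ≤ ε * (2 * C * ‖ν‖)^2 := by gcongr
        _ = m * ‖ν‖^2 := by rw [hεd]; field_simp; ring
    have hl : 2 * m * ‖ν‖^2 ≤ ‖ν‖^2 * LeviForm φ x (e x) := by
      have := mul_le_mul_of_nonneg_left h6'.le (sq_nonneg ‖ν‖)
      linarith
    have f1 := (abs_le.1 hT).1
    have f2 := (abs_le.1 b1').1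
    have f3 := (abs_le.1 b2').1
    rw [hDw, hHw] at f1
    have hms : 0 ≤ m * ‖ν‖^2 := by positivity
    linarith

lemma local_patch {N : ℕ} (φ : Cn N → ℝ) (x0 : Cn N) (hφ : ContDiffAt ℝ 2 φ x0)
    (hd : fderiv ℝ φ x0 ≠ 0) (hT : TwoPosEigen φ x0) (U : Set (Cn N)) (hU : U ∈ 𝓝 x0) :
    ∃ r > 0, ∃ c > 0, ball x0 (4 * r) ⊆ U ∧ ∃ A B : Cn N → Cn N, Continuous A ∧ Continuous B ∧
      ∀ x : Cn N, ∀ η : ℂ, ‖η‖ ≤ 1 →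
        (x ∉ ball x0 (3 * r) → x + η • A x + η^2 • B x = x) ∧
        ‖x + η • A x + η^2 • B x - x‖ ≤ r ∧
        φ x ≤ φ (x + η • A x + η^2 • B x) ∧
        (‖η‖ = 1 → φ x + c * ‖x + η • A x + η^2 • B x - x‖^2 ≤ φ (x + η • A x + η^2 • B x)) ∧
        (‖η‖ = 1 → x ∈ closedBall x0 (2 * r) → φ x + c ≤ φ (x + η • A x + η^2 • B x)) := by
  obtain ⟨r1, hr1, hrU, e, b, hec, hbc, C, hC, hCb, m, hm, t0, ht0, hest⟩ := lp_data φ x0 hφ hd hT U hU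
  set r := r1 / 4 with hr
  have hr0 : 0 < r := by positivity
  let χ : Cn N → ℝ := fun x => max 0 (min 1 (3 - ‖x - x0‖ / r))
  have hχc : Continuous χ := by fun_prop
  have hχ0 : ∀ x, 0 ≤ χ x := fun x => le_max_left _ _
  have hχ1 : ∀ x, χ x ≤ 1 := fun x => max_le zero_le_one (min_le_left _ _)
  have hχin : ∀ x ∈ closedBall x0 (2*r), χ x = 1 := by
    intro x hx
    rw [mem_closedBall, dist_eq_norm] at hx
    have : ‖x - x0‖ / r ≤ 2 := by rw [div_le_iff₀ hr0]; exact hx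
    simp only [χ]
    rw [min_eq_left (by linarith)]; simp
  have hχout : ∀ x, x ∉ ball x0 (3*r) → χ x = 0 := by
    intro x hx
    rw [mem_ball, dist_eq_norm, not_lt] at hx
    have : 3 ≤ ‖x - x0‖ / r := by rw [le_div_iff₀ hr0]; exact hx
    simp only [χ]
    exact max_eq_left ((min_le_right _ _).trans (by linarith))
  have hcut : ∀ (k : Cn N → ℝ) (g : Cn N → Cn N), Continuous k → (∀ x, x ∉ ball x0 (3*r) → k x = 0) →
      ContinuousOn g (ball x0 r1) → Continuous (fun x => k x • g x) := by
    intro k g hk hk0 hg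
    rw [continuous_iff_continuousAt]
    intro x
    by_cases hx : x ∈ ball x0 r1
    · exact hk.continuousAt.smul (hg.continuousAt (isOpen_ball.mem_nhds hx))
    · have : ∀ᶠ y in 𝓝 x, y ∉ ball x0 (3*r) := by
        have : x ∈ (closedBall x0 (3*r))ᶜ := by
          intro h; apply hx
          rw [mem_closedBall] at h; rw [mem_ball]
          refine lt_of_le_of_lt h ?_
          rw [hr]; linarith
        filter_upwards [isClosed_closedBall.isOpen_compl.mem_nhds this] with y hy
        exact fun h => hy (ball_subset_closedBall h)
      refine ContinuousAt.congr (f := fun _ => (0 : Cn N)) continuousAt_const ?_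
      filter_upwards [this] with y hy
      rw [hk0 y hy, zero_smul]
  obtain ⟨t, ht, htt0, ht1, htr⟩ : ∃ t > 0, t ≤ t0 ∧ t ≤ 1 ∧ 2 * C * t ≤ r :=
    ⟨min t0 (min 1 (r / (2 * C))), by positivity, by simp, by simp, by
      have : min t0 (min 1 (r / (2 * C))) ≤ r / (2*C) := by simp
      calc _ ≤ 2 * C * (r / (2*C)) := by gcongr
        _ = r := by field_simp⟩
  set c := min (m / (4 * C^2)) (m * t^2) with hc
  have hc0 : 0 < c := by positivity
  refine ⟨r, hr0, c, hc0, by rw [show 4 * r = r1 by rw [hr]; ring]; exact hrU, fun x => (χ x * t) • e x, fun x => ((χ x * t)^2) • b x,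
    hcut _ _ (by fun_prop) (fun x hx => by simp [hχout x hx]) hec,
    hcut _ _ (by fun_prop) (fun x hx => by simp [hχout x hx]) hbc, ?_⟩
  intro x η hη
  set ν : ℂ := η * ((χ x * t : ℝ) : ℂ) with hν
  have hy : x + η • ((χ x * t) • e x) + η^2 • ((χ x * t)^2 • b x) = x + ν • e x + ν^2 • b x := by
    congr 1
    · congr 1
      rw [hν, mul_smul η, cn_ofReal_smul]
    · rw [hν, mul_pow η, mul_smul (η^2), ← Complex.ofReal_pow, cn_ofReal_smul]
  have hνn : ‖ν‖ = ‖η‖ * (χ x * t) := by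
    rw [hν, norm_mul, Complex.norm_real, Real.norm_of_nonneg (mul_nonneg (hχ0 x) ht.le)]
  have hνt : ‖ν‖ ≤ t := by
    rw [hνn]
    have := hχ0 x; have := hχ1 x
    calc ‖η‖ * (χ x * t) ≤ 1 * (1 * t) := by gcongr
      _ = t := by ring
  simp only [hy]
  by_cases hx : x ∈ ball x0 (3*r)
  · have hx1 : x ∈ ball x0 r1 := ball_subset_ball (by rw [hr]; linarith) hx
    obtain ⟨ce, cb⟩ := hCb x hx1
    have hn0 := norm_nonneg ν
    have hwn : ‖x + ν • e x + ν^2 • b x - x‖ ≤ 2 * C * ‖ν‖ := by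
      rw [add_assoc, add_sub_cancel_left]
      refine (norm_add_le _ _).trans ?_
      rw [norm_smul, norm_smul, norm_pow]
      have : ‖ν‖^2 ≤ ‖ν‖ := by rw [pow_two]; exact mul_le_of_le_one_left hn0 (by linarith)
      have k1 : ‖ν‖ * ‖e x‖ ≤ ‖ν‖ * C := mul_le_mul_of_nonneg_left ce hn0
      have k2 : ‖ν‖^2 * ‖b x‖ ≤ ‖ν‖ * C := mul_le_mul this cb (norm_nonneg _) hn0
      linarith
    have hwr : ‖x + ν • e x + ν^2 • b x - x‖ ≤ r := hwn.trans (le_trans (by gcongr) htr)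
    have hyb : x + ν • e x + ν^2 • b x ∈ ball x0 r1 := by
      rw [mem_ball] at hx ⊢
      calc dist _ x0 ≤ dist (x + ν • e x + ν^2 • b x) x + dist x x0 := dist_triangle _ _ _
        _ < r + 3 * r := by rw [dist_eq_norm]; linarith
        _ = r1 := by rw [hr]; ring
    have hE := hest x hx1 ν (hνt.trans htt0) hyb
    have hE2 : φ x + c * ‖x + ν • e x + ν^2 • b x - x‖^2 ≤ φ (x + ν • e x + ν^2 • b x) := by
      refine le_trans ?_ hE
      have : c * ‖x + ν • e x + ν^2 • b x - x‖^2 ≤ m * ‖ν‖^2 := by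
        calc _ ≤ (m / (4 * C^2)) * (2 * C * ‖ν‖)^2 := by
              gcongr; exact min_le_left _ _
          _ = _ := by field_simp; ring
      linarith
    refine ⟨fun h => absurd hx h, hwr, ?_, fun _ => hE2, fun h1 h2 => ?_⟩
    · refine le_trans ?_ hE
      have : 0 ≤ m * ‖ν‖^2 := by positivity
      linarith
    · refine le_trans ?_ hE
      rw [hνn, h1, hχin x h2, one_mul, one_mul]
      have := min_le_right (m / (4 * C^2)) (m * t^2)
      rw [← hc] at this
      linarith
  · have hν0 : ν = 0 := by rw [hν, hχout x hx]; simp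
    have hx2 : x ∉ closedBall x0 (2*r) := fun h => hx (closedBall_subset_ball (by linarith) h)
    simp [hν0, hx2, hr0.le]

end

noncomputable section
open Set Filter Complex Metric
open scoped ENNReal Topology

lemma isOpen_level {N : ℕ} {X : Set (Cn N)} (hX : IsOpen X) {φ : Cn N → ℝ} (hφ : ContinuousOn φ X) (a : ℝ) :
    IsOpen {x ∈ X | a < φ x} := hφ.isOpen_inter_preimage hX isOpen_Ioi

lemma lift_lemma {N : ℕ} {R : ℝ} (hR : 1 < R) {X Y : Set (Cn N)} (hX : IsOpen X) (hY : IsOpen Y)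
    (φ : Cn N → ℝ) (hφ : ContinuousOn φ X) (a b : ℝ)
    (hC : IsCompact {x ∈ X | a ≤ φ x ∧ φ x ≤ b})
    (hreg : ∀ x ∈ X, a ≤ φ x → φ x ≤ b → ContDiffAt ℝ 2 φ x ∧ fderiv ℝ φ x ≠ 0 ∧ TwoPosEigen φ x)
    (hYsub : {x ∈ X | a < φ x} ⊆ Y) :
    Reach R Y {x ∈ X | a < φ x} {x ∈ X | b < φ x} := by
  classical
  rcases lt_or_ge b a with hba | hab
  · exact Reach.refl' (fun x hx => ⟨hx.1, hba.trans hx.2⟩)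
  set C := {x ∈ X | a ≤ φ x ∧ φ x ≤ b} with hCdef
  have hpatch : ∀ p : C, _ := fun p =>
    local_patch φ p (hreg p p.2.1 p.2.2.1 p.2.2.2).1 (hreg p p.2.1 p.2.2.1 p.2.2.2).2.1
      (hreg p p.2.1 p.2.2.1 p.2.2.2).2.2 X (hX.mem_nhds p.2.1)
  choose r hr c hc hrX A B hA hB hpush using hpatch
  obtain ⟨T, hT⟩ := hC.elim_finite_subcover (fun p : C => ball (p : Cn N) (r p)) (fun _ => isOpen_ball)
    (fun x hx => mem_iUnion.2 ⟨⟨x, hx⟩, by simpa using hr _⟩)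
  -- constants
  have hposr : ∃ μ > 0, ∀ p ∈ T, (T.card : ℝ) * μ ≤ r p := by
    have : ∃ μ > 0, ∀ p ∈ T, μ ≤ r p := by
      rcases T.eq_empty_or_nonempty with h | h
      · exact ⟨1, one_pos, by simp [h]⟩
      · exact ⟨T.inf' h r, by rw [gt_iff_lt, Finset.lt_inf'_iff]; exact fun p _ => hr p, fun p hp => Finset.inf'_le _ hp⟩
    obtain ⟨μ, hμ, h⟩ := this
    refine ⟨μ / (T.card + 1), by positivity, fun p hp => le_trans ?_ (h p hp)⟩
    rw [← mul_div_assoc, div_le_iff₀ (by positivity)]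
    nlinarith
  obtain ⟨μ, hμ, hμr⟩ := hposr
  obtain ⟨δ, hδ, hδc⟩ : ∃ δ > 0, ∀ p ∈ T, δ ≤ c p ∧ δ ≤ c p * μ^2 := by
    rcases T.eq_empty_or_nonempty with h | h
    · exact ⟨1, one_pos, by simp [h]⟩
    · refine ⟨T.inf' h (fun p => min (c p) (c p * μ^2)), ?_, fun p hp => ?_⟩
      · rw [gt_iff_lt, Finset.lt_inf'_iff]
        intro p _
        have := hc p
        positivity
      · have := Finset.inf'_le (fun p => min (c p) (c p * μ^2)) hp
        exact ⟨this.trans (min_le_left _ _), this.trans (min_le_right _ _)⟩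
  have key : ∀ a0, a ≤ a0 → ∀ S : Finset C, S ⊆ T → Reach R Y {x ∈ X | a0 < φ x}
      {x ∈ X | a0 < φ x ∧ (a0 + δ < φ x ∨ ∀ p ∈ S, x ∉ closedBall (p : Cn N) (2 * r p - S.card * μ))} := by
    intro a0 ha0 S
    induction S using Finset.induction_on with
    | empty => intro _; exact Reach.refl' (fun x hx => ⟨hx.1, hx.2, Or.inr (by simp)⟩)
    | insert j S hj ih =>
      intro hST
      refine (ih (fun p hp => hST (Finset.mem_insert_of_mem hp))).trans ?_
      have hjT : j ∈ T := hST (Finset.mem_insert_self _ _)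
      have hyX : ∀ x ∈ X, ∀ η : ℂ, ‖η‖ ≤ 1 → x + η • A j x + η^2 • B j x ∈ X := by
        intro x hx η hη
        obtain ⟨h1, h2, -, -, -⟩ := hpush j x η hη
        by_cases h : x ∈ ball (j : Cn N) (3 * r j)
        · apply hrX j
          rw [mem_ball] at h ⊢
          rw [← dist_eq_norm] at h2
          calc _ ≤ dist (x + η • A j x + η^2 • B j x) x + dist x j := dist_triangle _ _ _
            _ < 4 * r j := by linarith
        · rw [h1 h]; exact hx
      refine push_lemma hR hY ?_ (A j) (B j) (hA j) (hB j) ?_ ?_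
      · have o1 := isOpen_level hX hφ a0
        have o2 := isOpen_level hX hφ (a0 + δ)
        have o3 : IsOpen {x : Cn N | ∀ p ∈ insert j S, x ∉ closedBall (p : Cn N) (2 * r p - (insert j S).card * μ)} := by
          have : {x : Cn N | ∀ p ∈ insert j S, x ∉ closedBall (p : Cn N) (2 * r p - (insert j S).card * μ)}
              = ⋂ p ∈ insert j S, (closedBall (p : Cn N) (2 * r p - (insert j S).card * μ))ᶜ := by
            ext x; simp only [mem_iInter, mem_compl_iff]; rfl
          rw [this]
          exact isOpen_biInter_finset (fun p _ => isClosed_closedBall.isOpen_compl)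
        convert o1.inter (o2.union o3) using 1
        ext x
        simp only [mem_inter_iff, mem_union, mem_ofPred_eq]
        tauto
      · intro x hx η hη
        apply hYsub
        exact ⟨hyX x hx.1 η hη, ha0.trans_lt (hx.2.1.trans_le (hpush j x η hη).2.2.1)⟩
      · intro x hx η hη
        obtain ⟨h1, h2, h3, h4, h5⟩ := hpush j x η hη.le
        have h4 := h4 hη
        have h5 := h5 hη
        refine ⟨hyX x hx.1 η hη.le, hx.2.1.trans_le h3, ?_⟩
        set y := x + η • A j x + η^2 • B j x
        rcases hx.2.2 with hd | hd
        · left; linarith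
        by_cases hyx : μ ≤ ‖y - x‖
        · left
          have : c j * μ^2 ≤ c j * ‖y - x‖^2 := by
            have := hc j
            gcongr
          have := (hδc j hjT).2
          linarith [hx.2.1]
        push Not at hyx
        by_cases hyj : y ∈ closedBall (j : Cn N) (2 * r j - (insert j S).card * μ)
        · left
          have hxj : x ∈ closedBall (j : Cn N) (2 * r j) := by
            rw [mem_closedBall] at hyj ⊢
            have : dist x j ≤ dist x y + dist y j := dist_triangle _ _ _
            rw [dist_comm x y, dist_eq_norm y x] at this
            rw [Finset.card_insert_of_notMem hj] at hyj
            push_cast at hyj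
            have : 0 ≤ (S.card : ℝ) * μ := by positivity
            linarith
          have := h5 hxj
          linarith [hx.2.1, (hδc j hjT).1]
        · right
          intro p hp
          rcases Finset.mem_insert.1 hp with rfl | hp
          · exact hyj
          · intro hyp
            apply hd p hp
            rw [mem_closedBall] at hyp ⊢
            have : dist x p ≤ dist x y + dist y p := dist_triangle _ _ _
            rw [dist_comm x y, dist_eq_norm y x] at this
            rw [Finset.card_insert_of_notMem hj] at hyp
            push_cast at hyp
            linarith
  have step : ∀ a0, a ≤ a0 → Reach R Y {x ∈ X | a0 < φ x} {x ∈ X | min (a0 + δ) b < φ x} := by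
    intro a0 ha0
    refine (key a0 ha0 T (Finset.Subset.refl _)).mono subset_rfl ?_
    rintro x ⟨hx, hx1, hx2⟩
    refine ⟨hx, ?_⟩
    rcases hx2 with h | h
    · exact (min_le_left _ _).trans_lt h
    · refine (min_le_right _ _).trans_lt ?_
      by_contra hcon
      push Not at hcon
      have hxC : x ∈ C := ⟨hx, ha0.trans hx1.le, hcon⟩
      obtain ⟨p, hp, hxp⟩ := mem_iUnion₂.1 (hT hxC)
      apply h p hp
      rw [mem_closedBall]
      rw [mem_ball] at hxp
      linarith [hμr p hp]
  have iter : ∀ n : ℕ, Reach R Y {x ∈ X | a < φ x} {x ∈ X | min (a + n * δ) b < φ x} := by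
    intro n
    induction n with
    | zero => exact Reach.refl' (fun x hx => ⟨hx.1, (min_le_left _ _).trans_lt (by simpa using hx.2)⟩)
    | succ n ih =>
      refine ih.trans ((step (min (a + n * δ) b) (le_min (by have : 0 ≤ (n:ℝ) * δ := by positivity
                                                             linarith) hab)).mono subset_rfl ?_)
      intro x hx
      refine ⟨hx.1, lt_of_le_of_lt ?_ hx.2⟩
      push_cast
      rcases le_total (a + n * δ) b with h | h
      · rw [min_eq_left h]; apply le_of_eq; congr 1; ring
      · rw [min_eq_right h, min_eq_right (by linarith : b ≤ b + δ)]; exact min_le_right _ _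
  obtain ⟨n, hn⟩ := exists_nat_gt ((b - a) / δ)
  refine (iter n).mono subset_rfl ?_
  intro x hx
  rw [div_lt_iff₀ hδ] at hn
  refine ⟨hx.1, ?_⟩
  have := hx.2
  rwa [min_eq_right (by linarith)] at this

end

noncomputable section
open Set Filter Complex Metric
open scoped ENNReal Topology

lemma gen_pos {N : ℕ} {R : ℝ} (hR : 1 < R) {Y O : Set (Cn N)} (hY : IsOpen Y) (hO : IsOpen O)
    (p : Cn N) (V : Submodule ℝ (Cn N)) (hV : Module.finrank ℝ V + 1 < Module.finrank ℝ (Cn N)) :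
    Reach R Y O (O \ {x | x - p ∈ V}) := by
  intro f hf r hr hr1 hfY hfO ε hε
  have hfc : ContinuousOn f (closedBall 0 1) := hf.continuousOn.mono (closedBall_subset_ball hR)
  have hK := isCompact_circle_image hR hf
  have hcA : IsCompact {z : ℂ | r ≤ ‖z‖ ∧ ‖z‖ ≤ 1} := by
    refine (isCompact_closedBall (0:ℂ) 1).of_isClosed_subset ?_ (fun z hz => by simpa using hz.2)
    exact (isClosed_le continuous_const continuous_norm).inter (isClosed_le continuous_norm continuous_const)
  have hK3 : IsCompact (f '' {z : ℂ | r ≤ ‖z‖ ∧ ‖z‖ ≤ 1}) :=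
    hcA.image_of_continuousOn (hfc.mono (fun z hz => by simpa using hz.2))
  obtain ⟨δ1, hδ1, ht1⟩ := hK.exists_thickening_subset_open hO (by rintro _ ⟨z, hz, rfl⟩; exact hfO z hz)
  obtain ⟨δ2, hδ2, ht2⟩ := hK3.exists_thickening_subset_open hY (by rintro _ ⟨z, hz, rfl⟩; exact hfY z hz.1 hz.2)
  obtain ⟨δ, hδ, hd1, hd2, hd3⟩ : ∃ δ > 0, δ ≤ δ1 ∧ δ ≤ δ2 ∧ δ ≤ ε :=
    ⟨min δ1 (min δ2 ε), by positivity, by simp, by simp, by simp⟩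
  let E : ℝ → ℂ := fun θ => Complex.exp (θ * I)
  have hE : ContDiff ℝ 1 E := by
    have h1 : ContDiff ℝ 1 (fun θ : ℝ => (θ : ℂ) * I) := Complex.ofRealCLM.contDiff.mul contDiff_const
    exact h1.cexp
  have hEn : ∀ θ, ‖E θ‖ = 1 := fun θ => Complex.norm_exp_ofReal_mul_I θ
  have hfE : ContDiff ℝ 1 (fun θ => f (E θ)) := by
    have h1 : ContDiffOn ℂ 1 f (ball 0 R) := hf.contDiffOn isOpen_ball
    have h2 : ContDiffOn ℝ 1 f (ball 0 R) := h1.restrict_scalars ℝ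
    exact h2.comp_contDiff hE (fun θ => by simp [hEn]; linarith)
  let g : ℝ × V → Cn N := fun q => ((E q.1)^2)⁻¹ • (p + (q.2 : Cn N) - f (E q.1))
  have hg : ContDiff ℝ 1 g := by
    have e1 : ContDiff ℝ 1 (fun q : ℝ × V => E q.1) := hE.comp contDiff_fst
    have e2 : ContDiff ℝ 1 (fun q : ℝ × V => ((E q.1)^2)⁻¹) :=
      (e1.pow 2).inv (fun q => pow_ne_zero _ (fun h => by have := hEn q.1; rw [h] at this; simp at this))
    have e3 : ContDiff ℝ 1 (fun q : ℝ × V => (q.2 : Cn N)) := V.subtypeL.contDiff.comp contDiff_snd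
    have e4 : ContDiff ℝ 1 (fun q : ℝ × V => f (E q.1)) := hfE.comp contDiff_fst
    exact e2.smul ((contDiff_const.add e3).sub e4)
  have hdense := hg.dense_compl_range_of_finrank_lt_finrank (by
    rw [Module.finrank_prod, Module.finrank_self]; omega)
  obtain ⟨c, hc, hcr⟩ := hdense.exists_dist_lt 0 hδ
  rw [dist_zero_left] at hcr
  let F : ℂ → Cn N := fun z => f z + z^2 • c
  have hFf : ∀ z, ‖z‖ ≤ 1 → ‖F z - f z‖ < δ := by
    intro z hz
    simp only [F, add_sub_cancel_left, norm_smul, norm_pow]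
    refine lt_of_le_of_lt ?_ hcr
    exact mul_le_of_le_one_left (norm_nonneg _) (pow_le_one₀ (norm_nonneg _) hz)
  have hdf : DifferentiableAt ℂ f 0 := hf.differentiableAt (ball_mem_nhds _ (by linarith))
  refine ⟨F, ?_, ?_, ?_, fun z hz => (hFf z (hz.trans hr1.le)).trans_le hd3, ?_, ?_⟩
  · exact hf.add (Differentiable.differentiableOn (by fun_prop))
  · simp [F]
  · have e1 := (hasDerivAt_pow 2 (0:ℂ)).smul_const c
    have := (hdf.hasDerivAt.add e1).deriv
    simp only [Nat.cast_ofNat, Nat.add_one_sub_one, pow_one, mul_zero, zero_smul, add_zero] at this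
    exact this
  · intro z hz hz1
    refine ht2 (mem_thickening_iff.2 ⟨f z, ⟨z, ⟨hz, hz1⟩, rfl⟩, ?_⟩)
    rw [dist_eq_norm]; exact (hFf z hz1).trans_le hd2
  · intro z hz
    constructor
    · refine ht1 (mem_thickening_iff.2 ⟨f z, ⟨z, hz, rfl⟩, ?_⟩)
      rw [dist_eq_norm]; exact (hFf z hz.le).trans_le hd1
    · intro hcon
      apply hc
      have hzE : E z.arg = z := by
        have := Complex.norm_mul_exp_arg_mul_I z
        rw [hz] at this; simpa [E] using this
      refine ⟨(z.arg, ⟨F z - p, hcon⟩), ?_⟩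
      simp only [g, hzE, F]
      have hz0 : z ≠ 0 := by intro h; rw [h] at hz; simp at hz
      have : p + (f z + z^2 • c - p) - f z = z^2 • c := by abel
      rw [this, smul_smul, inv_mul_cancel₀ (pow_ne_zero 2 hz0), one_smul]

/-- several points -/
lemma gen_pos_finset {N : ℕ} {R : ℝ} (hR : 1 < R) {Y O : Set (Cn N)} (hY : IsOpen Y) (hO : IsOpen O)
    (T : Finset (Cn N)) (V : Cn N → Submodule ℝ (Cn N))
    (hV : ∀ p ∈ T, Module.finrank ℝ (V p) + 1 < Module.finrank ℝ (Cn N)) :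
    Reach R Y O {x ∈ O | ∀ p ∈ T, x - p ∉ V p} := by
  classical
  have : IsOpen {x ∈ O | ∀ p ∈ T, x - p ∉ V p} ∧ Reach R Y O {x ∈ O | ∀ p ∈ T, x - p ∉ V p} := by
    induction T using Finset.induction_on with
    | empty => simp only [Finset.notMem_empty, false_imp_iff, implies_true, and_true]
               exact ⟨hO, Reach.refl' (fun x hx => hx)⟩
    | insert p T hp ih =>
      obtain ⟨ho, ih⟩ := ih (fun q hq => hV q (Finset.mem_insert_of_mem hq))
      have heq : {x ∈ O | ∀ q ∈ insert p T, x - q ∉ V q} = {x ∈ O | ∀ p ∈ T, x - p ∉ V p} \ {x | x - p ∈ V p} := by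
        ext x
        simp only [Finset.forall_mem_insert, Set.mem_sdiff, mem_ofPred_eq]
        tauto
      rw [heq]
      have hcl : IsClosed {x : Cn N | x - p ∈ V p} :=
        (V p).closed_of_finiteDimensional.preimage (continuous_id.sub continuous_const)
      exact ⟨ho.sdiff hcl, ih.trans (gen_pos hR hY ho p (V p) (hV p (Finset.mem_insert_self _ _)))⟩
  exact this.2

end

noncomputable section
open Set Filter Complex Metric
open scoped ENNReal Topology

lemma smoothTransition_bounds : ∃ C > 0, ∀ x : ℝ, |deriv Real.smoothTransition x| ≤ C ∧
    |deriv (deriv Real.smoothTransition) x| ≤ C := by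
  have hg : ContDiff ℝ 2 Real.smoothTransition := Real.smoothTransition.contDiff
  have h1 : ContDiff ℝ 1 (deriv Real.smoothTransition) := by
    have : ContDiff ℝ (1+1) Real.smoothTransition := by norm_num; exact hg
    exact (contDiff_succ_iff_deriv.1 this).2.2
  have h2 : Continuous (deriv (deriv Real.smoothTransition)) := h1.continuous_deriv le_rfl
  obtain ⟨C1, hC1⟩ := (isCompact_Icc (a := (0:ℝ)) (b := 1)).exists_bound_of_continuousOn h1.continuous.continuousOn
  obtain ⟨C2, hC2⟩ := (isCompact_Icc (a := (0:ℝ)) (b := 1)).exists_bound_of_continuousOn h2.continuousOn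
  have hout : ∀ x : ℝ, x ∉ Icc (0:ℝ) 1 → deriv Real.smoothTransition =ᶠ[𝓝 x] fun _ => 0 := by
    intro x hx
    filter_upwards [isClosed_Icc.isOpen_compl.mem_nhds hx] with y hy
    have : ∃ c, Real.smoothTransition =ᶠ[𝓝 y] fun _ => c := by
      rcases lt_or_ge y 0 with h | h
      · refine ⟨0, ?_⟩
        filter_upwards [Iio_mem_nhds h] with z hz
        exact Real.smoothTransition.zero_of_nonpos (le_of_lt hz)
      · have h' : 1 < y := by by_contra h2; exact hy ⟨h, not_lt.1 h2⟩
        refine ⟨1, ?_⟩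
        filter_upwards [Ioi_mem_nhds h'] with z hz
        exact Real.smoothTransition.one_of_one_le (le_of_lt hz)
    obtain ⟨c, hc⟩ := this
    rw [hc.deriv_eq]; simp
  refine ⟨max (max C1 C2) 1, by positivity, fun x => ?_⟩
  by_cases hx : x ∈ Icc (0:ℝ) 1
  · have a1 := hC1 x hx
    have a2 := hC2 x hx
    rw [Real.norm_eq_abs] at a1 a2
    exact ⟨a1.trans (by simp), a2.trans (by simp)⟩
  · have e := hout x hx
    rw [e.eq_of_nhds, e.deriv_eq]
    simp

lemma cutoff_exists (ε : ℝ) (hε : 0 < ε) : ∃ q : ℝ, 0 < q ∧ q < 1 ∧ ∀ s1 : ℝ, 0 < s1 → ∃ B : ℝ → ℝ,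
    (∀ s, 0 ≤ s → ContDiffAt ℝ 2 B s) ∧ (∀ s, 0 ≤ B s ∧ B s ≤ 1) ∧
    (∀ s, 0 ≤ s → s ≤ q * s1 → B s = 1) ∧ (∀ s, s1 ≤ s → B s = 0) ∧
    (∀ s, 0 ≤ s → s < q * s1 → deriv B s = 0) ∧
    (∀ s, 0 ≤ s → deriv B s ≤ 0 ∧ s * |deriv B s| ≤ ε ∧ s^2 * |deriv (deriv B) s| ≤ ε) := by
  obtain ⟨C, hC, hCb⟩ := smoothTransition_bounds
  set L := max 1 (2 * C / ε) with hL
  have hL1 : 1 ≤ L := le_max_left _ _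
  have hL0 : 0 < L := by linarith
  have hLC : 2 * C ≤ ε * L := by
    have : 2 * C / ε ≤ L := le_max_right _ _
    rw [div_le_iff₀ hε] at this; linarith
  set q := Real.exp (-L) / 2 with hq
  have hq0 : 0 < q := by positivity
  have hq1 : q < 1 := by
    have : Real.exp (-L) < 1 := by rw [Real.exp_lt_one_iff]; linarith
    rw [hq]; linarith
  refine ⟨q, hq0, hq1, fun s1 hs1 => ?_⟩
  set s0 := q * s1 with hs0
  have hs00 : 0 < s0 := by positivity
  let h : ℝ → ℝ := fun s => (Real.log s1 - Real.log (s + s0)) / L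
  let B : ℝ → ℝ := fun s => Real.smoothTransition (h s)
  have hh : ∀ s, 0 ≤ s → HasDerivAt h (-(1/(L * (s + s0)))) s := by
    intro s hs
    have e1 : HasDerivAt (fun s => s + s0) 1 s := (hasDerivAt_id s).add_const s0
    have e2 := e1.log (by positivity)
    have e3 := (e2.const_sub (Real.log s1)).div_const L
    refine e3.congr_deriv ?_
    have : s + s0 ≠ 0 := by positivity
    field_simp
  have hh' : ∀ s, -s0 < s → HasDerivAt h (-(1/(L * (s + s0)))) s := by
    intro s hs
    have hne : s + s0 ≠ 0 := by linarith
    have e1 : HasDerivAt (fun s => s + s0) 1 s := (hasDerivAt_id s).add_const s0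
    have e2 := e1.log hne
    have e3 := (e2.const_sub (Real.log s1)).div_const L
    refine e3.congr_deriv ?_
    field_simp
  have hg : ContDiff ℝ 2 Real.smoothTransition := Real.smoothTransition.contDiff
  have hg1 : ContDiff ℝ 1 (deriv Real.smoothTransition) := by
    have : ContDiff ℝ (1+1) Real.smoothTransition := by norm_num; exact hg
    exact (contDiff_succ_iff_deriv.1 this).2.2
  have hgd : ∀ x, HasDerivAt Real.smoothTransition (deriv Real.smoothTransition x) x :=
    fun x => (hg.differentiable (by norm_num) x).hasDerivAt
  have hgd2 : ∀ x, HasDerivAt (deriv Real.smoothTransition) (deriv (deriv Real.smoothTransition) x) x :=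
    fun x => (hg1.differentiable (by norm_num) x).hasDerivAt
  have hBd : ∀ s, -s0 < s → HasDerivAt B (deriv Real.smoothTransition (h s) * (-(1/(L * (s + s0))))) s :=
    fun s hs => (hgd (h s)).comp s (hh' s hs)
  have hBdd : ∀ s, 0 ≤ s → HasDerivAt (deriv B) (deriv (deriv Real.smoothTransition) (h s) * (1/(L * (s + s0)))^2
      + deriv Real.smoothTransition (h s) * (1/(L * (s+s0)^2))) s := by
    intro s hs
    have hne : s + s0 ≠ 0 := by positivity
    have ev : deriv B =ᶠ[𝓝 s] fun s => deriv Real.smoothTransition (h s) * (-(1/(L * (s + s0)))) := by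
      filter_upwards [Ioi_mem_nhds (show -s0 < s by linarith)] with t ht
      exact (hBd t ht).deriv
    have e1 : HasDerivAt (fun s => deriv Real.smoothTransition (h s)) _ s := (hgd2 (h s)).comp s (hh s hs)
    have e2 : HasDerivAt (fun s => -(1/(L * (s + s0)))) (1/(L * (s+s0)^2)) s := by
      have a1 : HasDerivAt (fun s => L * (s + s0)) L s := by
        simpa using ((hasDerivAt_id s).add_const s0).const_mul L
      have a2 := (a1.inv (by positivity)).neg
      simp only [one_div]
      refine a2.congr_deriv ?_
      field_simp
    refine HasDerivAt.congr_of_eventuallyEq ?_ ev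
    refine (e1.mul e2).congr_deriv ?_
    ring
  have hmono : ∀ x, 0 ≤ deriv Real.smoothTransition x := fun x => Real.smoothTransition.monotone.deriv_nonneg
  have hone : ∀ s, 0 ≤ s → s ≤ s0 → B s = 1 := by
    intro s hs hss
    apply Real.smoothTransition.one_of_one_le
    simp only [h]
    rw [le_div_iff₀ hL0, one_mul]
    have : Real.log (s + s0) ≤ Real.log (Real.exp (-L) * s1) := by
      apply Real.log_le_log (by positivity)
      have : Real.exp (-L) * s1 = 2 * s0 := by rw [hs0, hq]; ring
      linarith
    rw [Real.log_mul (Real.exp_ne_zero _) hs1.ne', Real.log_exp] at this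
    linarith
  refine ⟨B, fun s hs => ?_, fun s => ⟨Real.smoothTransition.nonneg _, Real.smoothTransition.le_one _⟩, hone, ?_, ?_, ?_⟩
  · have : ContDiffAt ℝ 2 h s := by
      have e1 : ContDiffAt ℝ 2 (fun s => s + s0) s := contDiffAt_id.add contDiffAt_const
      exact (contDiffAt_const.sub (e1.log (by positivity))).div_const _
    exact hg.contDiffAt.comp s this
  · intro s hs
    apply Real.smoothTransition.zero_of_nonpos
    apply div_nonpos_of_nonpos_of_nonneg _ hL0.le
    have := Real.log_le_log hs1 (show s1 ≤ s + s0 by linarith)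
    linarith
  · intro s hs hss
    have ev : B =ᶠ[𝓝 s] fun _ => 1 := by
      filter_upwards [Ioo_mem_nhds (show -s0 < s by linarith) hss] with t ht
      rcases le_total 0 t with h0 | h0
      · exact hone t h0 ht.2.le
      · apply Real.smoothTransition.one_of_one_le
        have := hone 0 le_rfl hs00.le
        simp only [h]
        rw [le_div_iff₀ hL0, one_mul]
        have : Real.log (t + s0) ≤ Real.log (Real.exp (-L) * s1) := by
          apply Real.log_le_log (by linarith [ht.1])
          have : Real.exp (-L) * s1 = 2 * s0 := by rw [hs0, hq]; ring
          linarith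
        rw [Real.log_mul (Real.exp_ne_zero _) hs1.ne', Real.log_exp] at this
        linarith
    rw [ev.deriv_eq]; simp
  · intro s hs
    have hss : 0 < s + s0 := by positivity
    have hr : s / (s + s0) ≤ 1 := by rw [div_le_one hss]; linarith
    have hr0 : 0 ≤ s / (s + s0) := by positivity
    obtain ⟨c1, c2⟩ := hCb (h s)
    rw [(hBd s (by linarith)).deriv, (hBdd s hs).deriv]
    set g1 := deriv Real.smoothTransition (h s)
    set g2 := deriv (deriv Real.smoothTransition) (h s)
    have hCL : C / L ≤ ε / 2 := by rw [div_le_iff₀ hL0]; linarith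
    refine ⟨?_, ?_, ?_⟩
    · have := hmono (h s)
      have h2 : 0 ≤ 1/(L * (s + s0)) := by positivity
      nlinarith
    · rw [abs_mul, abs_neg, abs_of_pos (show 0 < 1/(L * (s + s0)) by positivity)]
      calc s * (|g1| * (1/(L * (s + s0)))) = |g1| / L * (s / (s + s0)) := by field_simp
        _ ≤ C / L * 1 := by gcongr
        _ ≤ ε := by linarith
    · calc s^2 * |g2 * (1/(L * (s + s0)))^2 + g1 * (1/(L * (s+s0)^2))|
          ≤ s^2 * (|g2| * (1/(L * (s + s0)))^2 + |g1| * (1/(L * (s+s0)^2))) := by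
            gcongr
            refine (abs_add_le _ _).trans ?_
            rw [abs_mul, abs_mul, abs_of_pos (show 0 < (1/(L * (s + s0)))^2 by positivity),
              abs_of_pos (show 0 < 1/(L * (s + s0)^2) by positivity)]
        _ = |g2| / L * (1 / L) * (s / (s + s0))^2 + |g1| / L * (s/(s+s0))^2 := by field_simp
        _ ≤ C / L * 1 * 1^2 + C / L * 1^2 := by
            gcongr
            rw [div_le_one hL0]; exact hL1
        _ ≤ ε := by linarith

end

noncomputable section
open Set Filter Complex Metric
open scoped ENNReal Topology

section D2calc
variable {E : Type*} [NormedAddCommGroup E] [NormedSpace ℝ E]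

lemma d2_line {φ : E → ℝ} {x : E} (h : ContDiffAt ℝ 2 φ x) (v : E) :
    HasDerivAt (fun t : ℝ => fderiv ℝ φ (x + t • v) v) (fderiv ℝ (fderiv ℝ φ) x v v) 0 := by
  have h1 : HasFDerivAt (fderiv ℝ φ) (fderiv ℝ (fderiv ℝ φ) x) (x + (0:ℝ) • v) := by
    simp only [zero_smul, add_zero]
    exact ((h.fderiv_right (m := 1) (by norm_num)).differentiableAt (by norm_num)).hasFDerivAt
  have h2 : HasDerivAt (fun t : ℝ => x + t • v) v 0 := by
    simpa using ((hasDerivAt_id (0:ℝ)).smul_const v).const_add x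
  have h3 := h1.comp_hasDerivAt (0:ℝ) h2
  have h4 := h3.clm_apply (hasDerivAt_const (0:ℝ) v)
  simpa using h4

lemma line_tendsto (x v : E) : Tendsto (fun t : ℝ => x + t • v) (𝓝 0) (𝓝 x) := by
  have : Continuous (fun t : ℝ => x + t • v) := by fun_prop
  simpa using this.tendsto 0

lemma d1_line {φ : E → ℝ} {x : E} (h : DifferentiableAt ℝ φ x) (v : E) :
    HasDerivAt (fun t : ℝ => φ (x + t • v)) (fderiv ℝ φ x v) 0 := by
  have h2 : HasDerivAt (fun t : ℝ => x + t • v) v 0 := by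
    simpa using ((hasDerivAt_id (0:ℝ)).smul_const v).const_add x
  have h1 : HasFDerivAt φ (fderiv ℝ φ x) (x + (0:ℝ) • v) := by simpa using h.hasFDerivAt
  exact h1.comp_hasDerivAt (0:ℝ) h2

lemma d2_eq {φ : E → ℝ} {x : E} (h : ContDiffAt ℝ 2 φ x) (v : E) {g : E → ℝ} {d : ℝ}
    (hg : ∀ᶠ y in 𝓝 x, fderiv ℝ φ y v = g y)
    (hd : HasDerivAt (fun t : ℝ => g (x + t • v)) d 0) :
    fderiv ℝ (fderiv ℝ φ) x v v = d := by
  refine (d2_line h v).unique (hd.congr_of_eventuallyEq ?_)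
  exact (line_tendsto x v).eventually hg

lemma d2_ev {φ : E → ℝ} {x : E} (h : ContDiffAt ℝ 2 φ x) : ∀ᶠ y in 𝓝 x, DifferentiableAt ℝ φ y :=
  (h.eventually (by simp)).mono fun _ hy => hy.differentiableAt (by norm_num)

lemma d2_add {f g : E → ℝ} {x : E} (hf : ContDiffAt ℝ 2 f x) (hg : ContDiffAt ℝ 2 g x) (v : E) :
    fderiv ℝ (fderiv ℝ (fun y => f y + g y)) x v v =
      fderiv ℝ (fderiv ℝ f) x v v + fderiv ℝ (fderiv ℝ g) x v v := by
  refine d2_eq (hf.add hg) v (g := fun y => fderiv ℝ f y v + fderiv ℝ g y v) ?_ ((d2_line hf v).add (d2_line hg v))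
  filter_upwards [d2_ev hf, d2_ev hg] with y h1 h2
  rw [fderiv_fun_add h1 h2]; rfl

lemma d2_sub {f g : E → ℝ} {x : E} (hf : ContDiffAt ℝ 2 f x) (hg : ContDiffAt ℝ 2 g x) (v : E) :
    fderiv ℝ (fderiv ℝ (fun y => f y - g y)) x v v =
      fderiv ℝ (fderiv ℝ f) x v v - fderiv ℝ (fderiv ℝ g) x v v := by
  refine d2_eq (hf.sub hg) v (g := fun y => fderiv ℝ f y v - fderiv ℝ g y v) ?_ ((d2_line hf v).sub (d2_line hg v))
  filter_upwards [d2_ev hf, d2_ev hg] with y h1 h2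
  rw [fderiv_fun_sub h1 h2]; rfl

lemma d2_mul {f g : E → ℝ} {x : E} (hf : ContDiffAt ℝ 2 f x) (hg : ContDiffAt ℝ 2 g x) (v : E) :
    fderiv ℝ (fderiv ℝ (fun y => f y * g y)) x v v =
      f x * fderiv ℝ (fderiv ℝ g) x v v + 2 * (fderiv ℝ f x v * fderiv ℝ g x v)
        + g x * fderiv ℝ (fderiv ℝ f) x v v := by
  have e1 := d1_line (hf.differentiableAt (by norm_num)) v
  have e2 := d1_line (hg.differentiableAt (by norm_num)) v
  have e := (e1.mul (d2_line hg v)).add (e2.mul (d2_line hf v))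
  refine d2_eq (hf.mul hg) v (g := fun y => f y * fderiv ℝ g y v + g y * fderiv ℝ f y v) ?_ (e.congr_deriv ?_)
  · filter_upwards [d2_ev hf, d2_ev hg] with y h1 h2
    rw [fderiv_fun_mul h1 h2]; rfl
  · simp; ring

lemma d1_comp {B : ℝ → ℝ} {s : E → ℝ} {x : E} (hB : DifferentiableAt ℝ B (s x)) (hs : DifferentiableAt ℝ s x) (v : E) :
    fderiv ℝ (fun y => B (s y)) x v = deriv B (s x) * fderiv ℝ s x v := by
  have := (hB.hasDerivAt.comp_hasFDerivAt x hs.hasFDerivAt).fderiv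
  change fderiv ℝ (B ∘ s) x v = _
  rw [this]; simp

lemma d2_comp {B : ℝ → ℝ} {s : E → ℝ} {x : E} (hB : ContDiffAt ℝ 2 B (s x)) (hs : ContDiffAt ℝ 2 s x) (v : E) :
    fderiv ℝ (fderiv ℝ (fun y => B (s y))) x v v =
      deriv (deriv B) (s x) * (fderiv ℝ s x v)^2 + deriv B (s x) * fderiv ℝ (fderiv ℝ s) x v v := by
  have hBev : ∀ᶠ t in 𝓝 (s x), ContDiffAt ℝ 2 B t := hB.eventually (by simp)
  have hB1 : DifferentiableAt ℝ (deriv B) (s x) := by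
    have h1 : ContDiffAt ℝ 1 (fderiv ℝ B) (s x) := hB.fderiv_right (by norm_num)
    have h2 : DifferentiableAt ℝ (fun t => fderiv ℝ B t 1) (s x) :=
      (h1.differentiableAt (by norm_num)).clm_apply (differentiableAt_const _)
    exact h2
  have e1 := d1_line (hs.differentiableAt (by norm_num)) v
  have e0 : HasDerivAt (deriv B) (deriv (deriv B) (s x)) (s (x + (0:ℝ) • v)) := by
    simpa using hB1.hasDerivAt
  have e2 := e0.comp (0:ℝ) e1
  have e := e2.mul (d2_line hs v)
  refine d2_eq (hB.comp x hs) v (g := fun y => deriv B (s y) * fderiv ℝ s y v) ?_ (e.congr_deriv ?_)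
  · filter_upwards [d2_ev hs, hs.continuousAt.eventually hBev] with y h1 h2
    exact d1_comp (h2.differentiableAt (by norm_num)) h1 v
  · simp; ring

lemma quad_hasFDerivAt (T : E →L[ℝ] E →L[ℝ] ℝ) (p x : E) :
    HasFDerivAt (fun y => T (y - p) (y - p)) (T (x - p) + T.flip (x - p)) x := by
  have e1 : HasFDerivAt (fun y => y - p) (ContinuousLinearMap.id ℝ E) x := (hasFDerivAt_id x).sub_const p
  have e2 : HasFDerivAt (fun y => T (y - p)) T x := (T.hasFDerivAt (x := x - p)).comp x e1
  refine (e2.clm_apply e1).congr_fderiv ?_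
  ext v; simp

lemma quad_d1 (T : E →L[ℝ] E →L[ℝ] ℝ) (hT : ∀ u v, T u v = T v u) (p x v : E) :
    fderiv ℝ (fun y => T (y - p) (y - p)) x v = 2 * T (x - p) v := by
  rw [(quad_hasFDerivAt T p x).fderiv]
  have := hT v (x - p)
  simp only [add_apply, ContinuousLinearMap.flip_apply, this]; ring

lemma quad_contDiff (T : E →L[ℝ] E →L[ℝ] ℝ) (p : E) : ContDiff ℝ 2 (fun y => T (y - p) (y - p)) := by
  have h1 : ContDiff ℝ 2 (fun y : E => y - p) := contDiff_id.sub contDiff_const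
  have h2 : ContDiff ℝ 2 (fun y => T (y - p)) := T.contDiff.comp h1
  exact h2.clm_apply h1

lemma quad_d2 (T : E →L[ℝ] E →L[ℝ] ℝ) (hT : ∀ u v, T u v = T v u) (p x v : E) :
    fderiv ℝ (fderiv ℝ (fun y => T (y - p) (y - p))) x v v = 2 * T v v := by
  refine d2_eq (quad_contDiff T p).contDiffAt v (g := fun y => 2 * T (y - p) v)
    (Eventually.of_forall fun y => quad_d1 T hT p y v) ?_
  have e : (fun t : ℝ => 2 * T (x + t • v - p) v) = fun t : ℝ => 2 * T (x - p) v + t * (2 * T v v) := by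
    funext t
    have : x + t • v - p = (x - p) + t • v := by abel
    rw [this, map_add, map_smul]; simp; ring
  rw [e]
  simpa using ((hasDerivAt_id (0:ℝ)).mul_const (2 * T v v)).const_add (2 * T (x - p) v)

/-- formula for the flattened function -/
lemma flat_calc (φ : E → ℝ) (B : ℝ → ℝ) (TS TP : E →L[ℝ] E →L[ℝ] ℝ) (hTS : ∀ u v, TS u v = TS v u)
    (hTP : ∀ u v, TP u v = TP v u) (p : E) (k : ℝ) (x : E) (hφ : ContDiffAt ℝ 2 φ x)
    (hB : ContDiffAt ℝ 2 B (TS (x - p) (x - p))) :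
    ContDiffAt ℝ 2 (fun y => φ y + B (TS (y - p) (y - p)) * (k + TP (y - p) (y - p) - φ y)) x ∧
    (∀ v, fderiv ℝ (fun y => φ y + B (TS (y - p) (y - p)) * (k + TP (y - p) (y - p) - φ y)) x v =
      fderiv ℝ φ x v + B (TS (x - p) (x - p)) * (2 * TP (x - p) v - fderiv ℝ φ x v) +
        (k + TP (x - p) (x - p) - φ x) * (deriv B (TS (x - p) (x - p)) * (2 * TS (x - p) v))) ∧
    (∀ v, fderiv ℝ (fderiv ℝ (fun y => φ y + B (TS (y - p) (y - p)) * (k + TP (y - p) (y - p) - φ y))) x v v =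
      fderiv ℝ (fderiv ℝ φ) x v v +
       (B (TS (x - p) (x - p)) * (2 * TP v v - fderiv ℝ (fderiv ℝ φ) x v v) +
        2 * ((deriv B (TS (x - p) (x - p)) * (2 * TS (x - p) v)) * (2 * TP (x - p) v - fderiv ℝ φ x v)) +
        (k + TP (x - p) (x - p) - φ x) * (deriv (deriv B) (TS (x - p) (x - p)) * (2 * TS (x - p) v)^2 +
          deriv B (TS (x - p) (x - p)) * (2 * TS v v)))) := by
  let s : E → ℝ := fun y => TS (y - p) (y - p)
  let P : E → ℝ := fun y => TP (y - p) (y - p)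
  have hs : ContDiffAt ℝ 2 s x := (quad_contDiff TS p).contDiffAt
  have hB' : ContDiffAt ℝ 2 B (s x) := hB
  have hs1 : ∀ v, fderiv ℝ s x v = 2 * TS (x - p) v := fun v => quad_d1 TS hTS p x v
  have hs2 : ∀ v, fderiv ℝ (fderiv ℝ s) x v v = 2 * TS v v := fun v => quad_d2 TS hTS p x v
  have hP : ContDiffAt ℝ 2 P x := (quad_contDiff TP p).contDiffAt
  have hkP : ContDiffAt ℝ 2 (fun y => k + P y) x := contDiffAt_const.add hP
  have hψ : ContDiffAt ℝ 2 (fun y => k + P y - φ y) x := hkP.sub hφ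
  have hβ : ContDiffAt ℝ 2 (fun y => B (s y)) x := ContDiffAt.comp x hB hs
  have hm : ContDiffAt ℝ 2 (fun y => B (s y) * (k + P y - φ y)) x := hβ.mul hψ
  have hdψ : ∀ v, fderiv ℝ (fun y => k + P y - φ y) x v = 2 * TP (x - p) v - fderiv ℝ φ x v := by
    intro v
    rw [fderiv_fun_sub (hkP.differentiableAt (by norm_num)) (hφ.differentiableAt (by norm_num)), fderiv_const_add]
    rw [sub_apply, quad_d1 TP hTP p x v]
  have hdβ : ∀ v, fderiv ℝ (fun y => B (s y)) x v = deriv B (s x) * (2 * TS (x - p) v) := by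
    intro v
    rw [d1_comp (B := B) (s := s) (hB'.differentiableAt (by norm_num)) (hs.differentiableAt (by norm_num)), hs1 v]
  refine ⟨hφ.add hm, fun v => ?_, fun v => ?_⟩
  · change fderiv ℝ (fun y => φ y + B (s y) * (k + P y - φ y)) x v = _
    rw [fderiv_fun_add (hφ.differentiableAt (by norm_num)) (hm.differentiableAt (by norm_num)),
      fderiv_fun_mul (hβ.differentiableAt (by norm_num)) (hψ.differentiableAt (by norm_num))]
    simp only [add_apply, smul_apply, smul_eq_mul]
    rw [hdψ, hdβ]
    simp only [s, P]; ring
  · change fderiv ℝ (fderiv ℝ (fun y => φ y + B (s y) * (k + P y - φ y))) x v v = _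
    rw [d2_add hφ hm, d2_mul hβ hψ, hdψ, hdβ, d2_comp (B := B) (s := s) hB' hs, hs1 v, hs2 v]
    have e2 : fderiv ℝ (fderiv ℝ (fun y => k + P y - φ y)) x v v = 2 * TP v v - fderiv ℝ (fderiv ℝ φ) x v v := by
      rw [d2_sub hkP hφ]
      have : fderiv ℝ (fun y => k + P y) = fderiv ℝ P := by funext y; rw [fderiv_const_add]
      rw [this, quad_d2 TP hTP p x v]
    rw [e2]

end D2calc
end

noncomputable section
open Set Filter Complex Metric
open scoped ENNReal Topology
section Flat
variable {E : Type*} [NormedAddCommGroup E] [NormedSpace ℝ E]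

lemma sylv [FiniteDimensional ℝ E] (H : E →L[ℝ] E →L[ℝ] ℝ) (hs : ∀ u v, H u v = H v u)
    (hnd : ∀ u, (∀ v, H u v = 0) → u = 0) :
    ∃ (TS : E →L[ℝ] E →L[ℝ] ℝ) (A : E →L[ℝ] E), (∀ u v, TS u v = TS v u) ∧
      (∀ u, 0 ≤ TS u u) ∧ (∃ c > 0, ∀ u, c * ‖u‖^2 ≤ TS u u) ∧ (∀ u, A (A u) = u) ∧
      (∀ u v, TS (A u) v = TS u (A v)) ∧ (∀ u v, H u v = 2 * TS (A u) v) := by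
  let Bf : LinearMap.BilinForm ℝ E := LinearMap.mk₂ ℝ (fun u v => H u v / 2)
    (by intros; simp; ring) (by intros; simp; ring) (by intros; simp; ring) (by intros; simp; ring)
  have hBf : ∀ u v, Bf u v = H u v / 2 := fun u v => rfl
  have hass : QuadraticMap.associated (R := ℝ) Bf.toQuadraticMap = Bf :=
    QuadraticMap.associated_left_inverse ℝ (fun u v => by rw [hBf, hBf, hs])
  obtain ⟨w, hw, ⟨e⟩⟩ := QuadraticForm.equivalent_one_neg_one_weighted_sum_squared Bf.toQuadraticMap
    (by
      rw [hass]; intro u hu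
      refine hnd u fun v => ?_
      have := hu v
      rw [hBf] at this; linarith)
  have he : ∀ u, H u u = 2 * ∑ i, w i * (e u i * e u i) := by
    intro u
    have h1 := e.map_app u
    rw [QuadraticMap.weightedSumSquares_apply, LinearMap.BilinMap.toQuadraticMap_apply, hBf] at h1
    simp only [smul_eq_mul] at h1
    linarith
  let L : E →ₗ[ℝ] (Fin (Module.finrank ℝ E) → ℝ) := e.toLinearEquiv
  have hL : ∀ u, L u = e u := fun u => rfl
  let TSl : E →ₗ[ℝ] E →ₗ[ℝ] ℝ := LinearMap.mk₂ ℝ (fun u v => ∑ i, L u i * L v i)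
    (by intros; simp [add_mul, Finset.sum_add_distrib]) (by intros; simp [Finset.mul_sum, mul_assoc])
    (by intros; simp [mul_add, Finset.sum_add_distrib]) (by intros; simp [Finset.mul_sum, mul_left_comm])
  let TS : E →L[ℝ] E →L[ℝ] ℝ := TSl.toContinuousBilinearMap
  have hTS : ∀ u v, TS u v = ∑ i, L u i * L v i := fun u v => rfl
  let D : (Fin (Module.finrank ℝ E) → ℝ) →ₗ[ℝ] (Fin (Module.finrank ℝ E) → ℝ) :=
    { toFun := fun y i => w i * y i
      map_add' := by intros; ext; simp [mul_add]
      map_smul' := by intros; ext; simp [mul_left_comm] }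
  let A : E →L[ℝ] E := LinearMap.toContinuousLinearMap (e.toLinearEquiv.symm.toLinearMap ∘ₗ D ∘ₗ L)
  have hA : ∀ u i, L (A u) i = w i * L u i := by
    intro u i
    have : L (A u) = D (L u) := e.toLinearEquiv.apply_symm_apply _
    rw [this]; rfl
  have hinj : ∀ u v, (∀ i, L u i = L v i) → u = v := fun u v h => e.toLinearEquiv.injective (funext h)
  have hw2 : ∀ i, w i * w i = 1 := by intro i; rcases hw i with h | h <;> rw [h] <;> norm_num
  have hsymTS : ∀ u v, TS u v = TS v u := by
    intro u v; rw [hTS, hTS]; exact Finset.sum_congr rfl fun i _ => mul_comm _ _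
  have hpos : ∀ u, 0 ≤ TS u u := fun u => by
    rw [hTS]; exact Finset.sum_nonneg fun i _ => mul_self_nonneg _
  have hAs : ∀ u v, TS (A u) v = TS u (A v) := by
    intro u v; rw [hTS, hTS]; exact Finset.sum_congr rfl fun i _ => by rw [hA, hA]; ring
  refine ⟨TS, A, hsymTS, hpos, ?_, ?_, hAs, ?_⟩
  · -- coercivity
    let M : (Fin (Module.finrank ℝ E) → ℝ) →L[ℝ] E := LinearMap.toContinuousLinearMap e.toLinearEquiv.symm.toLinearMap
    have hM : ∀ u, M (L u) = u := fun u => e.toLinearEquiv.symm_apply_apply u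
    refine ⟨1 / (‖M‖^2 + 1), by positivity, fun u => ?_⟩
    have h1 : ‖u‖ ≤ ‖M‖ * ‖L u‖ := by
      conv_lhs => rw [← hM u]
      exact M.le_opNorm _
    have h2 : ‖L u‖ ≤ √(TS u u) := by
      rw [pi_norm_le_iff_of_nonneg (Real.sqrt_nonneg _)]
      intro i
      refine Real.abs_le_sqrt ?_
      rw [hTS, pow_two]
      exact Finset.single_le_sum (f := fun i => L u i * L u i) (fun i _ => mul_self_nonneg _) (Finset.mem_univ i)
    have h3 : ‖L u‖^2 ≤ TS u u := by
      rw [← Real.sq_sqrt (hpos u)]; exact pow_le_pow_left₀ (norm_nonneg _) h2 2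
    have h4 : ‖u‖^2 ≤ ‖M‖^2 * ‖L u‖^2 := by
      rw [← mul_pow]; exact pow_le_pow_left₀ (norm_nonneg _) h1 2
    rw [div_mul_eq_mul_div, one_mul, div_le_iff₀ (by positivity)]
    have h5 := mul_le_mul_of_nonneg_left h3 (sq_nonneg ‖M‖)
    have := hpos u
    linarith
  · intro u; apply hinj; intro i; rw [hA, hA, ← mul_assoc, hw2, one_mul]
  · -- polarization
    have hq : ∀ u, H u u = 2 * TS (A u) u := by
      intro u; rw [he, hTS]; congr 1
      exact Finset.sum_congr rfl fun i _ => by rw [hA, hL]; ring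
    intro u v
    have h1 := hq (u + v)
    have h2 := hq u
    have h3 := hq v
    have h4 := hs u v
    have h5 := hAs u v
    have h6 := hsymTS u (A v)
    simp only [map_add, add_apply] at h1
    linarith

lemma ts_cs (TS : E →L[ℝ] E →L[ℝ] ℝ) (hs : ∀ u v, TS u v = TS v u) (hp : ∀ u, 0 ≤ TS u u) (u v : E) :
    |TS u v| ≤ √(TS u u) * √(TS v v) := by
  rw [← Real.sqrt_mul (hp u)]
  refine Real.abs_le_sqrt ?_
  have h : ∀ t : ℝ, 0 ≤ TS u u * (t * t) + (2 * TS u v) * t + TS v v := by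
    intro t
    have h1 := hp (t • u + v)
    have h2 := hs u v
    simp only [map_add, map_smul, add_apply, smul_apply, smul_eq_mul] at h1
    rw [← h2] at h1
    linarith
  have := discrim_le_zero h
  rw [discrim] at this
  nlinarith

/-- numeric core of the flattening lemma -/
lemma flat_core (TS : E →L[ℝ] E →L[ℝ] ℝ) (A : E →L[ℝ] E) (hs : ∀ u v, TS u v = TS v u)
    (hp : ∀ u, 0 ≤ TS u u) (hpd : ∀ u, TS u u = 0 → u = 0) (hAA : ∀ u, A (A u) = u)
    (hAs : ∀ u v, TS (A u) v = TS u (A v)) (TP : E →L[ℝ] E →L[ℝ] ℝ)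
    (hTP : ∀ u v, TP u v = (1/2) * (TS u v + TS (A u) v))
    (φ : E → ℝ) (p : E) (b κ ω ε s0 : ℝ) (B : ℝ → ℝ) (hω : 0 ≤ ω) (hω' : ω ≤ 1/4) (hε : 0 < ε) (hε' : ε < 1/4)
    (hs0 : 0 < s0) (hκ : 0 < κ) (hκs : 8 * κ ≤ s0)
    (hB1 : ∀ s, 0 ≤ s → ContDiffAt ℝ 2 B s) (hB2 : ∀ s, 0 ≤ B s ∧ B s ≤ 1)
    (hB3 : ∀ s, 0 ≤ s → s ≤ s0 → B s = 1)
    (hB5 : ∀ s, 0 ≤ s → s < s0 → deriv B s = 0)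
    (hB6 : ∀ s, 0 ≤ s → deriv B s ≤ 0 ∧ s * |deriv B s| ≤ ε ∧ s^2 * |deriv (deriv B) s| ≤ ε)
    (x : E) (hφ : ContDiffAt ℝ 2 φ x)
    (e0 : |φ x - b - TS (A (x - p)) (x - p)| ≤ ω * TS (x - p) (x - p))
    (e1 : ∀ v, |fderiv ℝ φ x v - 2 * TS (A (x - p)) v| ≤ ω * (√(TS (x - p) (x - p)) * √(TS v v))) :
    ∀ τ : E → ℝ, τ = (fun y => φ y + B (TS (y - p) (y - p)) * ((b - 2 * κ) + TP (y - p) (y - p) - φ y)) →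
    ContDiffAt ℝ 2 τ x ∧
    (|τ x - φ x| ≤ 2 * κ + 2 * TS (x - p) (x - p)) ∧
    (φ x > b - κ → A (x - p) ≠ - (x - p) → τ x > b - 2 * κ) ∧
    (fderiv ℝ τ x = 0 → τ x = b - 2 * κ) ∧
    (∀ v, fderiv ℝ (fderiv ℝ τ) x v v ≥
      (1 - B (TS (x - p) (x - p))) * fderiv ℝ (fderiv ℝ φ) x v v
        + 2 * B (TS (x - p) (x - p)) * TP v v - 24 * ε * TS v v) := by
  rintro τ rfl
  have hAn : ∀ u, TS (A u) (A u) = TS u u := fun u => by rw [hAs, hAA]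
  have hTPs : ∀ u v, TP u v = TP v u := by
    intro u v; rw [hTP, hTP, hs u v, hAs u v, hs u (A v)]
  obtain ⟨c1, c2, c3⟩ := flat_calc φ B TS TP hs hTPs p (b - 2 * κ) x hφ (hB1 _ (hp _))
  set y := x - p with hy
  set S := TS y y with hS
  set J := TS (A y) y with hJ
  have hPP : TP y y = (1/2) * (S + J) := hTP y y
  have hS0 : 0 ≤ S := hp y
  have hPn : 0 ≤ S + J := by
    have h := hp (y + A y)
    have h2 := hAn y
    have h3 := hs y (A y)
    simp only [map_add, add_apply] at h
    linarith
  have hPn0 : S + J = 0 → A y = - y := by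
    intro h0
    have h : TS (y + A y) (y + A y) = 0 := by
      have h2 := hAn y
      have h3 := hs y (A y)
      simp only [map_add, add_apply]
      linarith
    have := hpd _ h
    exact (neg_eq_of_add_eq_zero_right this).symm
  have hnn : 0 ≤ S - J := by
    have h := hp (y - A y)
    have h2 := hAn y
    have h3 := hs y (A y)
    simp only [map_sub, sub_apply] at h
    linarith
  have hb := hB2 S
  obtain ⟨hd1, hd2, hd3⟩ := hB6 S hS0
  set β := B S
  set β' := deriv B S
  set β'' := deriv (deriv B) S
  set ψ := b - 2 * κ + TP y y - φ x with hψ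
  obtain ⟨e0a, e0b⟩ := abs_le.1 e0
  have hωS : ω * S ≤ 1/4 * S := mul_le_mul_of_nonneg_right hω' hS0
  have hωS0 : 0 ≤ ω * S := mul_nonneg hω hS0
  have hψ1 : ψ ≤ (5/4) * S := by rw [hψ, hPP]; linarith
  have hψ2 : -(2 * κ) - 1/4 * S + (1/2) * (S - J) ≤ ψ := by rw [hψ, hPP]; linarith
  have hψabs : |ψ| ≤ 2 * κ + 2 * S := by
    rw [abs_le]; constructor <;> linarith
  have hψS : s0 ≤ S → |ψ| ≤ 2 * S := by
    intro h; rw [abs_le]; constructor <;> linarith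
  refine ⟨c1, ?_, ?_, ?_, ?_⟩
  · have : φ x + β * ψ - φ x = β * ψ := by ring
    change |φ x + β * ψ - φ x| ≤ _
    rw [this, abs_mul, abs_of_nonneg hb.1]
    calc β * |ψ| ≤ 1 * |ψ| := mul_le_mul_of_nonneg_right hb.2 (abs_nonneg _)
      _ ≤ _ := by linarith
  · intro h1 h2
    change φ x + β * ψ > _
    have hP : 0 < S + J := lt_of_le_of_ne hPn fun h => h2 (hPn0 h.symm)
    have e : φ x + β * ψ = (1 - β) * φ x + β * (b - 2 * κ + (1/2) * (S + J)) := by rw [hψ, hPP]; ring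
    rw [e]
    rcases hb.1.eq_or_lt with h0 | h0
    · rw [← h0]; linarith
    · have q1 : (1 - β) * (b - κ) ≤ (1 - β) * φ x := mul_le_mul_of_nonneg_left h1.le (by linarith [hb.2])
      have q2 : 0 < β * (1/2 * (S + J)) := by positivity
      have q3 : β * κ ≤ κ := by have := mul_le_mul_of_nonneg_right hb.2 hκ.le; linarith
      linarith
  · intro h0
    change φ x + β * ψ = _
    have hv := c2 (A y)
    rw [h0, zero_apply] at hv
    have t1 : TS y (A y) = J := hs _ _
    have t2 : TP y (A y) = (1/2) * (S + J) := by rw [hTP, t1, hAn]; ring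
    rw [t1, t2] at hv
    have d := e1 (A y)
    rw [hAn y, ← hS, Real.mul_self_sqrt hS0] at d
    obtain ⟨d1, -⟩ := abs_le.1 d
    have d1 : (7/4) * S ≤ fderiv ℝ φ x (A y) := by linarith
    have hmain : (1 - β) * fderiv ℝ φ x (A y) + β * (S + J) + 2 * (ψ * (β' * J)) = 0 := by linarith
    have q1 : (1 - β) * ((7/4) * S) ≤ (1 - β) * fderiv ℝ φ x (A y) :=
      mul_le_mul_of_nonneg_left d1 (by linarith [hb.2])
    have q2 : 0 ≤ β * (S + J) := mul_nonneg hb.1 hPn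
    have q3 : 0 ≤ (1 - β) * ((7/4) * S) := mul_nonneg (by linarith [hb.2]) (by linarith)
    have key : β = 1 → S + J = 0 → φ x + β * ψ = b - 2 * κ := by
      intro h1 h2
      rw [hψ, hPP, h1, h2]; ring
    rcases lt_or_ge S s0 with hlt | hge
    · have b1 : β = 1 := hB3 S hS0 hlt.le
      have b2 : β' = 0 := hB5 S hS0 hlt
      rw [b1, b2] at hmain
      exact key b1 (by linarith)
    · have hSp : 0 < S := by linarith
      rcases le_or_gt J 0 with hJ0 | hJ0
      · have q4 : 0 ≤ ψ := by linarith
        have q5 : 0 ≤ ψ * (β' * J) := mul_nonneg q4 (mul_nonneg_of_nonpos_of_nonpos hd1 hJ0)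
        have q6 : (1 - β) * ((7/4) * S) = 0 := by linarith
        have b1 : β = 1 := by
          rcases mul_eq_zero.1 q6 with h | h
          · linarith
          · exfalso; linarith
        rw [b1] at q2 hmain
        exact key b1 (by linarith)
      · exfalso
        have q4 : |ψ * (β' * J)| ≤ 2 * ε * S := by
          rw [abs_mul, abs_mul, abs_of_pos hJ0]
          calc |ψ| * (|β'| * J) ≤ (2 * S) * (|β'| * S) :=
                mul_le_mul (hψS hge) (mul_le_mul_of_nonneg_left (by linarith) (abs_nonneg _))
                  (mul_nonneg (abs_nonneg _) hJ0.le) (by linarith)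
            _ = 2 * S * (S * |β'|) := by ring
            _ ≤ 2 * S * ε := mul_le_mul_of_nonneg_left hd2 (by linarith)
            _ = _ := by ring
        have q5 := (abs_le.1 q4).1
        have q6 : ε * S < 1/4 * S := mul_lt_mul_of_pos_right hε' hSp
        have q7 : β * S ≤ β * (S + J) := mul_le_mul_of_nonneg_left (by linarith) hb.1
        have q8 : 0 ≤ (1 - β) * S := mul_nonneg (by linarith [hb.2]) hS0
        linarith
  · intro v
    rw [c3 v]
    set V := TS v v
    have hV : 0 ≤ V := hp v
    set a := √S with ha
    set c := √V with hc
    have haa : a * a = S := Real.mul_self_sqrt hS0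
    have hcc : c * c = V := Real.mul_self_sqrt hV
    have ha0 : 0 ≤ a := Real.sqrt_nonneg _
    have hc0 : 0 ≤ c := Real.sqrt_nonneg _
    have hac : 0 ≤ a * c := mul_nonneg ha0 hc0
    have f1 : |TS y v| ≤ a * c := ts_cs TS hs hp y v
    have f2 : |TS (A y) v| ≤ a * c := by
      have := ts_cs TS hs hp (A y) v
      rwa [hAn] at this
    have f3 : |2 * TP y v - fderiv ℝ φ x v| ≤ 3 * (a * c) := by
      have e := e1 v
      have e' : ω * (a * c) ≤ 1/4 * (a * c) := mul_le_mul_of_nonneg_right hω' hac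
      have h1 := abs_le.1 f1
      have h2 := abs_le.1 f2
      have h3 := abs_le.1 e
      rw [hTP, abs_le]
      constructor <;> linarith [h1.1, h1.2, h2.1, h2.2, h3.1, h3.2]
    have g1 : |(β' * (2 * TS y v)) * (2 * TP y v - fderiv ℝ φ x v)| ≤ 6 * ε * V := by
      rw [abs_mul, abs_mul, abs_mul, abs_two]
      calc |β'| * (2 * |TS y v|) * |2 * TP y v - fderiv ℝ φ x v| ≤ |β'| * (2 * (a * c)) * (3 * (a * c)) := by
            gcongr
        _ = 6 * ((a * a) * |β'|) * (c * c) := by ring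
        _ ≤ 6 * ε * V := by rw [haa, hcc]; gcongr
    have hsq : (2 * TS y v)^2 ≤ 4 * (S * V) := by
      rw [mul_pow, ← sq_abs (TS y v)]
      calc (2:ℝ)^2 * |TS y v|^2 ≤ 2^2 * (a * c)^2 := by gcongr
        _ = 4 * ((a * a) * (c * c)) := by ring
        _ = _ := by rw [haa, hcc]
    have g2 : |ψ * (β'' * (2 * TS y v)^2)| ≤ 8 * ε * V := by
      rcases lt_or_ge S s0 with hlt | hge
      · have : β'' * (2 * TS y v)^2 = 0 := by
          rcases hS0.eq_or_lt with h0 | h0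
          · have : (2 * TS y v)^2 = 0 := le_antisymm (by rw [← h0] at hsq; linarith) (sq_nonneg _)
            rw [this, mul_zero]
          · have : β'' = 0 := by
              have hev : deriv B =ᶠ[𝓝 S] fun _ => 0 := by
                filter_upwards [Ioo_mem_nhds h0 hlt] with t ht
                exact hB5 t ht.1.le ht.2
              change deriv (deriv B) S = 0
              rw [hev.deriv_eq]; simp
            rw [this, zero_mul]
        rw [this, mul_zero, abs_zero]; positivity
      · rw [abs_mul, abs_mul, abs_of_nonneg (sq_nonneg (2 * TS y v))]
        calc |ψ| * (|β''| * (2 * TS y v)^2) ≤ (2 * S) * (|β''| * (4 * (S * V))) := by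
              gcongr; exact hψS hge
          _ = 8 * (S^2 * |β''|) * V := by ring
          _ ≤ 8 * ε * V := by gcongr
    have g3 : |ψ * (β' * (2 * V))| ≤ 4 * ε * V := by
      rcases lt_or_ge S s0 with hlt | hge
      · have b2 : β' = 0 := hB5 S hS0 hlt
        rw [b2, zero_mul, mul_zero, abs_zero]; positivity
      · rw [abs_mul, abs_mul, abs_of_nonneg (by linarith : (0:ℝ) ≤ 2 * V)]
        calc |ψ| * (|β'| * (2 * V)) ≤ (2 * S) * (|β'| * (2 * V)) := by
              gcongr; exact hψS hge
          _ = 4 * (S * |β'|) * V := by ring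
          _ ≤ 4 * ε * V := by gcongr
    have k1 := (abs_le.1 g1).1
    have k2 := (abs_le.1 g2).1
    have k3 := (abs_le.1 g3).1
    linarith
end Flat
end

noncomputable section
open Set Filter Complex Metric
open scoped ENNReal Topology

lemma crit_est {E : Type*} [NormedAddCommGroup E] [NormedSpace ℝ E] (φ : E → ℝ) (p : E) (hφ : ContDiffAt ℝ 2 φ p)
    (hD : fderiv ℝ φ p = 0) (δ : ℝ) (hδ : 0 < δ) :
    ∃ r > 0, ∀ x ∈ ball p r, ContDiffAt ℝ 2 φ x ∧
      |φ x - φ p - 1/2 * fderiv ℝ (fderiv ℝ φ) p (x - p) (x - p)| ≤ δ * ‖x - p‖^2 ∧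
      (∀ v, |fderiv ℝ φ x v - fderiv ℝ (fderiv ℝ φ) p (x - p) v| ≤ δ * ‖x - p‖ * ‖v‖) ∧
      (∀ v, |fderiv ℝ (fderiv ℝ φ) x v v - fderiv ℝ (fderiv ℝ φ) p v v| ≤ δ * ‖v‖^2) := by
  have h1 : ∀ᶠ x in 𝓝 p, ContDiffAt ℝ 2 φ x := hφ.eventually (by norm_num)
  have hd1 : ContDiffAt ℝ 1 (fderiv ℝ φ) p := hφ.fderiv_right (by norm_num)
  have hd2 : ContinuousAt (fderiv ℝ (fderiv ℝ φ)) p :=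
    (hd1.fderiv_right (m := 0) (by norm_num)).continuousAt
  have h2 : ∀ᶠ x in 𝓝 p, ‖fderiv ℝ (fderiv ℝ φ) x - fderiv ℝ (fderiv ℝ φ) p‖ ≤ δ := by
    have := (Metric.continuousAt_iff' (β := E) (α := E →L[ℝ] E →L[ℝ] ℝ) (f := fderiv ℝ (fderiv ℝ φ)) (b := p)).1 hd2 δ hδ
    filter_upwards [this] with x hx
    exact (le_of_eq (dist_eq_norm (E := E →L[ℝ] E →L[ℝ] ℝ) _ _).symm).trans hx.le
  obtain ⟨r, hr, hb⟩ := Metric.eventually_nhds_iff_ball.1 (h1.and h2)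
  refine ⟨r, hr, fun x hx => ⟨(hb x hx).1, ?_, ?_, ?_⟩⟩
  · have := taylor2 φ p r δ (fun y hy => (hb y hy).1.contDiffWithinAt) p (x - p) (mem_ball_self hr)
      (by simpa using hx) (fun y hy => (hb y hy).2)
    rw [hD] at this
    simpa using this
  · intro v
    have hdiff : ∀ y ∈ ball p r, HasFDerivWithinAt (fderiv ℝ φ) (fderiv ℝ (fderiv ℝ φ) y) (ball p r) y := by
      intro y hy
      have : ContDiffAt ℝ 1 (fderiv ℝ φ) y := (hb y hy).1.fderiv_right (by norm_num)
      exact (this.differentiableAt (by norm_num)).hasFDerivAt.hasFDerivWithinAt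
    have := Convex.norm_image_sub_le_of_norm_hasFDerivWithin_le' hdiff (fun y hy => (hb y hy).2)
      (convex_ball p r) (mem_ball_self hr) hx
    rw [hD, sub_zero] at this
    have h3 := (fderiv ℝ φ x - fderiv ℝ (fderiv ℝ φ) p (x - p)).le_opNorm v
    rw [sub_apply, Real.norm_eq_abs] at h3
    exact h3.trans (mul_le_mul_of_nonneg_right this (norm_nonneg _))
  · intro v
    have h3 := (fderiv ℝ (fderiv ℝ φ) x - fderiv ℝ (fderiv ℝ φ) p).le_opNorm₂ v v
    rw [sub_apply, sub_apply, Real.norm_eq_abs] at h3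
    calc _ ≤ _ := h3
      _ ≤ δ * ‖v‖ * ‖v‖ := by gcongr; exact (hb x hx).2
      _ = _ := by ring

lemma finrank_neg {N : ℕ} (V : Submodule ℝ (Cn N)) (W : Submodule ℂ (Cn N)) (hW : Module.finrank ℂ W = 2)
    (h : ∀ e ∈ W, e ∈ V → I • e ∈ V → e = 0) : Module.finrank ℝ V + 1 < Module.finrank ℝ (Cn N) := by
  let m : Cn N →ₗ[ℝ] (Cn N ⧸ V) := V.mkQ
  let i : Cn N →ₗ[ℝ] Cn N := (LinearMap.lsmul ℂ (Cn N) I).restrictScalars ℝ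
  let f : W →ₗ[ℝ] (Cn N ⧸ V) × (Cn N ⧸ V) := (m.prod (m ∘ₗ i)) ∘ₗ (W.subtype.restrictScalars ℝ)
  have hinj : Function.Injective f := by
    rw [← LinearMap.ker_eq_bot, LinearMap.ker_eq_bot']
    intro e he
    have h1 : m (e : Cn N) = 0 := congrArg Prod.fst he
    have h2 : m (I • (e : Cn N)) = 0 := congrArg Prod.snd he
    have := h e e.2 ((Submodule.Quotient.mk_eq_zero V).1 h1) ((Submodule.Quotient.mk_eq_zero V).1 h2)
    exact Subtype.ext this
  have h1 := LinearMap.finrank_le_finrank_of_injective hinj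
  rw [Module.finrank_prod] at h1
  have h2 : Module.finrank ℝ W = 4 := by
    have := Module.finrank_mul_finrank ℝ ℂ W
    rw [Complex.finrank_real_complex, hW] at this
    omega
  have h3 := V.finrank_quotient_add_finrank
  omega

lemma levi_coercive {N : ℕ} (H : Cn N →L[ℝ] Cn N →L[ℝ] ℝ) (W : Submodule ℂ (Cn N))
    (h : ∀ e ∈ W, e ≠ 0 → 0 < H e e + H (I • e) (I • e)) :
    ∃ m > 0, ∀ e ∈ W, m * ‖e‖^2 ≤ H e e + H (I • e) (I • e) := by
  have hcont : Continuous fun e : Cn N => H e e + H (I • e) (I • e) := by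
    have hi : Continuous fun e : Cn N => I • e := continuous_const_smul I
    exact ((H.continuous.clm_apply continuous_id).add
      ((H.continuous.comp hi).clm_apply hi))
  have hK : IsCompact ((W : Set (Cn N)) ∩ sphere 0 1) :=
    (isCompact_sphere 0 1).inter_left (Submodule.closed_of_finiteDimensional W)
  obtain ⟨m, hm, hmb⟩ : ∃ m > 0, ∀ e ∈ (W : Set (Cn N)) ∩ sphere 0 1, m ≤ H e e + H (I • e) (I • e) := by
    rcases ((W : Set (Cn N)) ∩ sphere 0 1).eq_empty_or_nonempty with he | hne
    · exact ⟨1, one_pos, by simp [he]⟩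
    · obtain ⟨e, he, hmin⟩ := hK.exists_isMinOn hne hcont.continuousOn
      exact ⟨_, h e he.1 (by rintro rfl; simpa using he.2), fun e' he' => hmin he'⟩
  refine ⟨m, hm, fun e he => ?_⟩
  rcases eq_or_ne e 0 with rfl | hne
  · simp
  · have hn : 0 < ‖e‖ := norm_pos_iff.2 hne
    have hmem : ((‖e‖⁻¹ : ℝ) • e) ∈ (W : Set (Cn N)) ∩ sphere 0 1 := by
      refine ⟨?_, ?_⟩
      · rw [← cn_ofReal_smul]; exact W.smul_mem _ he
      · simp [norm_smul, hn.ne']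
    have := hmb _ hmem
    rw [smul_comm I] at this
    simp only [map_smul, smul_apply, smul_eq_mul] at this
    have h2 : m * ‖e‖^2 ≤ (‖e‖⁻¹ * (‖e‖⁻¹ * H e e) + ‖e‖⁻¹ * (‖e‖⁻¹ * H (I • e) (I • e))) * ‖e‖^2 :=
      mul_le_mul_of_nonneg_right this (by positivity)
    have h3 : (‖e‖⁻¹ * (‖e‖⁻¹ * H e e) + ‖e‖⁻¹ * (‖e‖⁻¹ * H (I • e) (I • e))) * ‖e‖^2
        = H e e + H (I • e) (I • e) := by field_simp
    linarith

lemma flatten {N : ℕ} (φ : Cn N → ℝ) (p : Cn N) (b : ℝ) (hφ : ContDiffAt ℝ 2 φ p) (hb : φ p = b)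
    (hD : fderiv ℝ φ p = 0) (hnd : ∀ u, (∀ v, fderiv ℝ (fderiv ℝ φ) p u v = 0) → u = 0)
    (hL : TwoPosEigen φ p) :
    ∃ V : Submodule ℝ (Cn N), Module.finrank ℝ V + 1 < Module.finrank ℝ (Cn N) ∧
      ∀ U ∈ 𝓝 p, ∀ κ0 > 0, ∃ κp > 0, ∀ κ, 0 < κ → κ ≤ κp →
        ∃ (τ : Cn N → ℝ) (C : Set (Cn N)), p ∈ C ∧ C ⊆ U ∧ IsClosed C ∧ (∀ x ∉ C, τ x = φ x) ∧
          (∀ x, |τ x - φ x| ≤ κ0) ∧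
          (∀ x ∈ C, ContDiffAt ℝ 2 τ x ∧ TwoPosEigen τ x ∧ (fderiv ℝ τ x = 0 → τ x = b - 2 * κ)) ∧
          (∀ x ∈ C, x - p ∉ V → b - κ < φ x → b - 2 * κ < τ x) := by
  set H := fderiv ℝ (fderiv ℝ φ) p with hH
  have hsym : ∀ u v, H u v = H v u := fun u v => (hφ.isSymmSndFDerivAt (by simp)) u v
  obtain ⟨TS, A, hs, hp, ⟨c, hc, hcoer⟩, hAA, hAs, hHT⟩ := sylv H hsym hnd
  obtain ⟨W, hW2, hWpos⟩ := hL
  have hWpos' : ∀ e ∈ W, e ≠ 0 → 0 < H e e + H (I • e) (I • e) := by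
    intro e he hne
    have := hWpos e he hne
    rw [levi_eq] at this
    linarith
  obtain ⟨m, hm, hmb⟩ := levi_coercive H W hWpos'
  let V : Submodule ℝ (Cn N) := LinearMap.ker ((A : Cn N →ₗ[ℝ] Cn N) + LinearMap.id)
  have hV : ∀ u, u ∈ V ↔ A u = - u := by
    intro u
    rw [LinearMap.mem_ker]
    simp [add_eq_zero_iff_eq_neg]
  have hpd : ∀ u, TS u u = 0 → u = 0 := by
    intro u hu
    have h1 := hcoer u
    rw [hu] at h1
    have h2 : ‖u‖^2 ≤ 0 := by
      by_contra hcon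
      push Not at hcon
      have := mul_pos hc hcon
      linarith
    have h3 : ‖u‖ = 0 := by
      have := le_antisymm h2 (sq_nonneg _)
      exact pow_eq_zero_iff (two_ne_zero) |>.1 this
    exact norm_eq_zero.1 h3
  refine ⟨V, finrank_neg V W hW2 ?_, ?_⟩
  · intro e he h1 h2
    by_contra hne
    have h3 := hWpos' e he hne
    rw [hHT, hHT, (hV _).1 h1, (hV _).1 h2] at h3
    have h4 := hp e
    have h5 := hp (I • e)
    simp only [map_neg, neg_apply] at h3
    linarith
  intro U hU κ0 hκ0
  -- constants
  set M := ‖TS‖ with hM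
  have hM0 : 0 ≤ M := ContinuousLinearMap.opNorm_nonneg _
  set ε := min (1/8) (m / (100 * (M + 1))) with hεd
  have hε : 0 < ε := lt_min (by norm_num) (by positivity)
  have hε1 : ε ≤ 1/8 := min_le_left _ _
  have hε2 : ε * (100 * (M + 1)) ≤ m := by
    have := min_le_right (1/8) (m / (100 * (M + 1)))
    rwa [← hεd, le_div_iff₀ (by positivity)] at this
  obtain ⟨r, hr, hest⟩ := crit_est φ p hφ hD (c * ε) (by positivity)
  obtain ⟨r', hr', hUr⟩ := Metric.mem_nhds_iff.1 hU
  -- cutoff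
  obtain ⟨q, hq0, hq1, hq⟩ := cutoff_exists ε hε
  set r2 := min r r' with hr2
  have hr2p : 0 < r2 := lt_min hr hr'
  set s1 := min (c * r2^2 / 2) (κ0 / 4) with hs1
  have hs1p : 0 < s1 := lt_min (by positivity) (by positivity)
  obtain ⟨B, hB1, hB2, hB3, hB4, hB5, hB6⟩ := hq s1 hs1p
  have hs0 : 0 < q * s1 := mul_pos hq0 hs1p
  have hs01 : q * s1 ≤ s1 := by
    have := mul_le_mul_of_nonneg_right hq1.le hs1p.le; linarith
  refine ⟨q * s1 / 8, by positivity, fun κ hκ hκp => ?_⟩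
  let TP : Cn N →L[ℝ] Cn N →L[ℝ] ℝ := (1/2 : ℝ) • (TS + TS.comp A)
  have hTP : ∀ u v, TP u v = (1/2) * (TS u v + TS (A u) v) := by
    intro u v; simp [TP, mul_add]
  have hball : ∀ x, TS (x - p) (x - p) ≤ s1 → x ∈ ball p r2 := by
    intro x hx
    have h1 := hcoer (x - p)
    have h2 : s1 ≤ c * r2^2 / 2 := min_le_left _ _
    rw [mem_ball, dist_eq_norm]
    by_contra hcon
    push Not at hcon
    have h3 : r2^2 ≤ ‖x - p‖^2 := pow_le_pow_left₀ hr2p.le hcon 2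
    have h4 := mul_le_mul_of_nonneg_left h3 hc.le
    have : 0 < c * r2^2 := by positivity
    linarith
  have hcont : Continuous fun x => TS (x - p) (x - p) := (quad_contDiff TS p).continuous
  set τ : Cn N → ℝ := fun y => φ y + B (TS (y - p) (y - p)) * ((b - 2 * κ) + TP (y - p) (y - p) - φ y) with hτ
  have hsqrt : ∀ u, √c * ‖u‖ ≤ √(TS u u) := by
    intro u
    refine Real.le_sqrt_of_sq_le ?_
    rw [mul_pow, Real.sq_sqrt hc.le]; exact hcoer u
  have hcs : ∀ u v, c * (‖u‖ * ‖v‖) ≤ √(TS u u) * √(TS v v) := by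
    intro u v
    have h := mul_le_mul (hsqrt u) (hsqrt v) (by positivity) (by positivity)
    have h2 := Real.mul_self_sqrt hc.le
    calc c * (‖u‖ * ‖v‖) = (√c * √c) * (‖u‖ * ‖v‖) := by rw [h2]
      _ = √c * ‖u‖ * (√c * ‖v‖) := by ring
      _ ≤ _ := h
  have hcore := fun x (hx : TS (x - p) (x - p) ≤ s1) => by
    obtain ⟨g1, g2, g3, -⟩ := hest x (ball_subset_ball (min_le_left _ _) (hball x hx))
    exact flat_core TS A hs hp hpd hAA hAs TP hTP φ p b κ ε ε (q * s1) B hε.le (by linarith) hε (by linarith) hs0 hκ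
      (by linarith) hB1 hB2 hB3 hB5 hB6 x g1
      (by
        rw [hb, hHT] at g2
        have h1 := mul_le_mul_of_nonneg_left (hcoer (x - p)) hε.le
        have e : φ x - b - 1 / 2 * (2 * TS (A (x - p)) (x - p)) = φ x - b - TS (A (x - p)) (x - p) := by ring
        rw [e] at g2
        linarith)
      (by
        intro v
        have h1 := g3 v
        rw [hHT] at h1
        have h2 := mul_le_mul_of_nonneg_left (hcs (x - p) v) hε.le
        linarith) τ hτ
  refine ⟨τ, {x | TS (x - p) (x - p) ≤ s1}, by simpa using hs1p.le, ?_, isClosed_le hcont continuous_const, ?_, ?_, ?_, ?_⟩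
  · intro x hx
    exact hUr (ball_subset_ball (min_le_right _ _) (hball x hx))
  · intro x hx
    rw [mem_ofPred_eq, not_le] at hx
    rw [hτ]; simp only [hB4 _ hx.le]; ring
  · intro x
    rcases le_or_gt (TS (x - p) (x - p)) s1 with hx | hx
    · have h := (hcore x hx).2.1
      have : s1 ≤ κ0 / 4 := min_le_right _ _
      linarith
    · rw [hτ]; simp only [hB4 _ hx.le]; simpa using hκ0.le
  · intro x hx
    obtain ⟨k1, k2, k3, k4, k5⟩ := hcore x hx
    refine ⟨k1, ⟨W, hW2, fun e he hne => ?_⟩, k4⟩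
    obtain ⟨g1, -, -, g4⟩ := hest x (ball_subset_ball (min_le_left _ _) (hball x hx))
    obtain ⟨b0, b1⟩ := hB2 (TS (x - p) (x - p))
    set β := B (TS (x - p) (x - p))
    have hnI : ‖I • e‖ = ‖e‖ := by rw [norm_smul]; simp
    -- lower bound for each vector
    have hlow : ∀ u : Cn N, ‖u‖ = ‖e‖ → H u u - (c * ε) * ‖e‖^2 - 24 * ε * (M * ‖e‖^2) ≤ fderiv ℝ (fderiv ℝ τ) x u u := by
      intro u hu
      have h1 := k5 u
      have h2 := (abs_le.1 (g4 u)).1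
      rw [hu] at h2
      have h3 : TS u u ≤ M * ‖e‖^2 := by
        have := (le_abs_self _).trans (TS.le_opNorm₂ u u)
        rw [hu] at this
        calc _ ≤ _ := this
          _ = _ := by ring
      have h4 := mul_le_mul_of_nonneg_left h3 (by linarith : (0:ℝ) ≤ 24 * ε)
      have h5 : (1 - β) * (H u u - (c * ε) * ‖e‖^2) ≤ (1 - β) * fderiv ℝ (fderiv ℝ φ) x u u :=
        mul_le_mul_of_nonneg_left (by linarith) (by linarith)
      have h6 : H u u ≤ 2 * TP u u := by
        rw [hHT, hTP]
        -- TS (A u) u ≤ TS u u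
        have h7 := hp (u - A u)
        have h8 : TS (A u) (A u) = TS u u := by rw [hAs, hAA]
        have h9 := hs u (A u)
        simp only [map_sub, sub_apply] at h7
        linarith
      have h10 := mul_le_mul_of_nonneg_left h6 b0
      have h11 : 0 ≤ β * ((c * ε) * ‖e‖^2) := by positivity
      linarith
    rw [levi_eq]
    have l1 := hlow e rfl
    have l2 := hlow (I • e) hnI
    have l3 := hmb e he
    have hn : 0 < ‖e‖^2 := by have := norm_pos_iff.2 hne; positivity
    -- c ≤ M
    have hcM : c ≤ M := by
      have h1 := hcoer e
      have h2 := (le_abs_self _).trans (TS.le_opNorm₂ e e)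
      have h3 : c * ‖e‖^2 ≤ M * ‖e‖^2 := by
        calc _ ≤ _ := h1
          _ ≤ _ := h2
          _ = _ := by ring
      exact le_of_mul_le_mul_right h3 hn
    have h5 : (c * ε) * ‖e‖^2 ≤ (M * ε) * ‖e‖^2 := by gcongr
    have h6 : ε * (100 * (M + 1)) * ‖e‖^2 ≤ m * ‖e‖^2 := by gcongr
    have h7 : 0 < ε * ‖e‖^2 := by positivity
    have h8 : 0 ≤ M * ε * ‖e‖^2 := by positivity
    linarith
  · intro x hx hxV hφx
    exact (hcore x hx).2.2.1 hφx fun h => hxV ((hV _).2 h)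
end

noncomputable section
open Set Filter Complex Metric
open scoped ENNReal Topology

lemma twoPos_congr {N : ℕ} {φ τ : Cn N → ℝ} {x : Cn N} (h : τ =ᶠ[𝓝 x] φ) (hφ : TwoPosEigen φ x) : TwoPosEigen τ x := by
  obtain ⟨W, h1, h2⟩ := hφ
  refine ⟨W, h1, fun v hv hne => ?_⟩
  have := h2 v hv hne
  rw [levi_eq] at this ⊢
  rwa [(h.fderiv).fderiv_eq]

lemma crit_finite {N : ℕ} (φ : Cn N → ℝ) (K : Set (Cn N)) (hK : IsCompact K)
    (h : ∀ x ∈ K, ContDiffAt ℝ 2 φ x ∧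
      (fderiv ℝ φ x = 0 → ∀ u, (∀ v, fderiv ℝ (fderiv ℝ φ) x u v = 0) → u = 0)) :
    {x ∈ K | fderiv ℝ φ x = 0}.Finite := by
  by_contra hinf
  obtain ⟨x, hx, hacc⟩ := Set.Infinite.exists_accPt_of_subset_isCompact hinf hK (sep_subset _ _)
  rw [accPt_iff_frequently_nhdsNE] at hacc
  obtain ⟨h1, h2⟩ := h x hx
  have hd1 : ContDiffAt ℝ 1 (fderiv ℝ φ) x := h1.fderiv_right (by norm_num)
  by_cases h0 : fderiv ℝ φ x = 0
  · have hnd := h2 h0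
    have hder : HasFDerivAt (fderiv ℝ φ) (fderiv ℝ (fderiv ℝ φ) x) x :=
      (hd1.differentiableAt (by norm_num)).hasFDerivAt
    have hanti : ∃ C, AntilipschitzWith C (fderiv ℝ (fderiv ℝ φ) x) := by
      obtain ⟨C, -, hC⟩ := LinearMap.exists_antilipschitzWith
        ((fderiv ℝ (fderiv ℝ φ) x : Cn N →L[ℝ] (Cn N →L[ℝ] ℝ)) : Cn N →ₗ[ℝ] (Cn N →L[ℝ] ℝ)) (by
          rw [LinearMap.ker_eq_bot']
          intro u hu
          refine hnd u fun v => ?_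
          have hu' : fderiv ℝ (fderiv ℝ φ) x u = 0 := hu
          rw [hu']; rfl)
      exact ⟨C, hC⟩
    have := hder.eventually_ne (c := 0) hanti
    exact hacc (this.mono fun y hy hy' => hy hy'.2)
  · have hc : ContinuousAt (fderiv ℝ φ) x := hd1.continuousAt
    have := (hc.eventually_ne h0).filter_mono (nhdsWithin_le_nhds (s := {x}ᶜ))
    exact hacc (this.mono fun y hy hy' => hy hy'.2)

lemma progress {N : ℕ} {R : ℝ} (hR : 1 < R) {X Y : Set (Cn N)} (hX : IsOpen X) (hY : IsOpen Y)
    (φ : Cn N → ℝ) (hφ : ContinuousOn φ X) (b η : ℝ) (hη : 0 < η)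
    (hC : IsCompact {x ∈ X | b - η ≤ φ x ∧ φ x ≤ b + η})
    (hreg : ∀ x ∈ X, b - η ≤ φ x → φ x ≤ b + η → ContDiffAt ℝ 2 φ x ∧ TwoPosEigen φ x ∧
      (fderiv ℝ φ x = 0 → ∀ u, (∀ v, fderiv ℝ (fderiv ℝ φ) x u v = 0) → u = 0))
    (hYsub : {x ∈ X | b - η < φ x} ⊆ Y) :
    ∃ κ > 0, Reach R Y {x ∈ X | b - κ < φ x} {x ∈ X | b + κ < φ x} := by
  have hKf := crit_finite φ _ hC (fun x hx => ⟨(hreg x hx.1 hx.2.1 hx.2.2).1, (hreg x hx.1 hx.2.1 hx.2.2).2.2⟩)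
  set K := {x ∈ {x ∈ X | b - η ≤ φ x ∧ φ x ≤ b + η} | fderiv ℝ φ x = 0} with hKd
  -- gap
  obtain ⟨κ0, hκ0, hκ0η, hgap⟩ : ∃ κ0 > 0, 8 * κ0 ≤ η ∧ ∀ x ∈ K, φ x ≠ b → 4 * κ0 < |φ x - b| := by
    have e1 : ∀ᶠ t : ℝ in 𝓝[>] 0, ∀ x ∈ K, φ x ≠ b → 4 * t < |φ x - b| := by
      rw [Filter.eventually_all_finite hKf]
      intro x _
      by_cases hxb : φ x = b
      · exact Eventually.of_forall fun t h => absurd hxb h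
      · have : 0 < |φ x - b| / 4 := by have := abs_pos.2 (sub_ne_zero.2 hxb); positivity
        filter_upwards [nhdsWithin_le_nhds (Iio_mem_nhds this)] with t ht _
        have ht : t < |φ x - b| / 4 := ht
        linarith
    have e2 : ∀ᶠ t : ℝ in 𝓝[>] 0, 8 * t ≤ η := by
      filter_upwards [nhdsWithin_le_nhds (Iio_mem_nhds (by positivity : 0 < η / 8))] with t ht
      have ht : t < η / 8 := ht
      linarith
    obtain ⟨t, ⟨h1, h2⟩, h3⟩ := ((e1.and e2).and self_mem_nhdsWithin).exists
    exact ⟨t, h3, h2, h1⟩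
  have hTf : {x ∈ K | φ x = b}.Finite := hKf.subset (sep_subset _ _)
  set T : Finset (Cn N) := hTf.toFinset with hT
  have hTm : ∀ p, p ∈ T ↔ p ∈ K ∧ φ p = b := fun p => by rw [hT, Set.Finite.mem_toFinset]; rfl
  obtain ⟨U, hU, hUd⟩ := T.finite_toSet.t2_separation
  have hfl : ∀ p ∈ T, _ := fun p hp => by
    have h1 := (hTm p).1 hp
    have h2 := hreg p h1.1.1.1 h1.1.1.2.1 h1.1.1.2.2
    exact flatten φ p b h2.1 h1.2 h1.1.2 (h2.2.2 h1.1.2) h2.2.1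
  choose! V hV hfl2 using hfl
  have hfl3 := fun p hp => hfl2 p hp (U p) ((hU p).2.mem_nhds (hU p).1) κ0 hκ0
  choose! κp hκp hfl4 using hfl3
  obtain ⟨κ, hκ, hκ2, hκle⟩ : ∃ κ > 0, 2 * κ ≤ κ0 ∧ ∀ p ∈ T, κ ≤ κp p := by
    have e1 : ∀ᶠ t : ℝ in 𝓝[>] 0, ∀ p ∈ T, t ≤ κp p := by
      rw [Filter.eventually_all_finset]
      intro p hp
      filter_upwards [nhdsWithin_le_nhds (Iio_mem_nhds (hκp p hp))] with t ht
      exact (show t < κp p from ht).le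
    have e2 : ∀ᶠ t : ℝ in 𝓝[>] 0, 2 * t ≤ κ0 := by
      filter_upwards [nhdsWithin_le_nhds (Iio_mem_nhds (by positivity : 0 < κ0 / 2))] with t ht
      have ht : t < κ0 / 2 := ht
      linarith
    obtain ⟨t, ⟨h1, h2⟩, h3⟩ := ((e1.and e2).and self_mem_nhdsWithin).exists
    exact ⟨t, h3, h2, h1⟩
  have hfl5 := fun p hp => hfl4 p hp κ hκ (hκle p hp)
  choose! τp C hpC hCU hCcl hτout hτclose hτreg hτlow using hfl5
  let τ : Cn N → ℝ := fun x => φ x + ∑ p ∈ T, (τp p x - φ x)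
  have hτU : ∀ p ∈ T, ∀ x ∈ U p, τ x = τp p x := by
    intro p hp x hx
    have : ∑ q ∈ T, (τp q x - φ x) = τp p x - φ x := by
      refine Finset.sum_eq_single_of_mem p hp fun q hq hqp => ?_
      have hxq : x ∉ C q := fun h => by
        have := hUd hq hp hqp
        exact Set.disjoint_left.1 this (hCU q hq h) hx
      rw [hτout q hq x hxq, sub_self]
    simp only [τ, this]; ring
  have hτo : ∀ x, (∀ p ∈ T, x ∉ C p) → τ x = φ x := by
    intro x hx
    have : ∑ q ∈ T, (τp q x - φ x) = 0 := Finset.sum_eq_zero fun q hq => by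
      rw [hτout q hq x (hx q hq), sub_self]
    simp only [τ, this, add_zero]
  have hevU : ∀ p ∈ T, ∀ x ∈ C p, τ =ᶠ[𝓝 x] τp p := fun p hp x hx => by
    filter_upwards [(hU p).2.mem_nhds (hCU p hp hx)] with y hy using hτU p hp y hy
  have hevo : ∀ x, (∀ p ∈ T, x ∉ C p) → τ =ᶠ[𝓝 x] φ := fun x hx => by
    have : ∀ᶠ y in 𝓝 x, ∀ p ∈ T, y ∉ C p := by
      rw [Filter.eventually_all_finset]
      exact fun p hp => (hCcl p hp).isOpen_compl.mem_nhds (hx p hp)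
    filter_upwards [this] with y hy using hτo y hy
  have hcases : ∀ x, (∃ p ∈ T, x ∈ C p) ∨ (∀ p ∈ T, x ∉ C p) := fun x => by
    by_cases h : ∃ p ∈ T, x ∈ C p
    · exact Or.inl h
    · right; push Not at h; exact h
  have hclose : ∀ x, |τ x - φ x| ≤ κ0 := by
    intro x
    rcases hcases x with ⟨p, hp, hx⟩ | hx
    · rw [hτU p hp x (hCU p hp hx)]; exact hτclose p hp x
    · rw [hτo x hx, sub_self, abs_zero]; exact hκ0.le
  have hτc : ContinuousOn τ X := by
    intro x hx
    refine ContinuousAt.continuousWithinAt ?_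
    rcases hcases x with ⟨p, hp, hxC⟩ | hxC
    · exact ((hτreg p hp x hxC).1.continuousAt).congr (hevU p hp x hxC).symm
    · exact (hφ.continuousAt (hX.mem_nhds hx)).congr (hevo x hxC).symm
  have hlift : ∀ θ > b - 2 * κ, Reach R Y {x ∈ X | θ < τ x} {x ∈ X | b + 2 * κ0 < τ x} := by
    intro θ hθ
    have hband : ∀ x, θ ≤ τ x → τ x ≤ b + 2 * κ0 → |φ x - b| ≤ 3 * κ0 := by
      intro x h1 h2
      have := abs_le.1 (hclose x)
      rw [abs_le]; constructor <;> linarith [this.1, this.2]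
    refine lift_lemma hR hX hY τ hτc θ (b + 2 * κ0) ?_ ?_ ?_
    · have e : {x ∈ X | θ ≤ τ x ∧ τ x ≤ b + 2 * κ0} =
          {x ∈ X | b - η ≤ φ x ∧ φ x ≤ b + η} ∩ τ ⁻¹' (Icc θ (b + 2 * κ0)) := by
        ext x
        constructor
        · rintro ⟨h1, h2, h3⟩
          have := abs_le.1 (hband x h2 h3)
          exact ⟨⟨h1, by linarith [this.1], by linarith [this.2]⟩, h2, h3⟩
        · rintro ⟨⟨h1, -, -⟩, h2, h3⟩
          exact ⟨h1, h2, h3⟩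
      rw [e]
      refine hC.of_isClosed_subset ?_ inter_subset_left
      exact (hτc.mono (sep_subset _ _)).preimage_isClosed_of_isClosed hC.isClosed isClosed_Icc
    · intro x hx h1 h2
      rcases hcases x with ⟨p, hp, hxC⟩ | hxC
      · obtain ⟨k1, k2, k3⟩ := hτreg p hp x hxC
        have hev := hevU p hp x hxC
        refine ⟨k1.congr_of_eventuallyEq hev, ?_, twoPos_congr hev k2⟩
        rw [hev.fderiv_eq]
        intro h0
        have := k3 h0
        rw [hev.eq_of_nhds] at h1
        linarith
      · have hev := hevo x hxC
        have hb3 := hband x h1 h2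
        have hb4 := abs_le.1 hb3
        have hb5 : b - η ≤ φ x ∧ φ x ≤ b + η := ⟨by linarith [hb4.1], by linarith [hb4.2]⟩
        obtain ⟨k1, k2, k3⟩ := hreg x hx hb5.1 hb5.2
        refine ⟨k1.congr_of_eventuallyEq hev, ?_, twoPos_congr hev k2⟩
        rw [hev.fderiv_eq]
        intro h0
        have hxK : x ∈ K := ⟨⟨hx, hb5⟩, h0⟩
        by_cases hxb : φ x = b
        · have hxT : x ∈ T := (hTm x).2 ⟨hxK, hxb⟩
          exact hxC x hxT (hpC x hxT)
        · have := hgap x hxK hxb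
          linarith
    · rintro x ⟨h1, h2⟩
      have := abs_le.1 (hclose x)
      exact hYsub ⟨h1, by linarith [this.1, this.2]⟩
  refine ⟨κ, hκ, ?_⟩
  have r1 : Reach R Y {x ∈ X | b - κ < φ x} {x ∈ X | b - 2 * κ < τ x} := by
    refine (gen_pos_finset hR hY (isOpen_level hX hφ (b - κ)) T V hV).mono subset_rfl ?_
    rintro x ⟨⟨h1, h2⟩, h3⟩
    refine ⟨h1, ?_⟩
    rcases hcases x with ⟨p, hp, hxC⟩ | hxC
    · rw [hτU p hp x (hCU p hp hxC)]
      exact hτlow p hp x hxC (h3 p hp) h2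
    · rw [hτo x hxC]; linarith
  have r2 : Reach R Y {x ∈ X | b - 2 * κ < τ x} {x ∈ X | b + 2 * κ0 < τ x} := by
    refine Reach.of_levels hR τ (b - 2 * κ) (hτc.mono (sep_subset _ _)) (fun x hx => hx.2) fun θ hθ => ?_
    exact (hlift θ hθ).mono (fun x hx => ⟨hx.1.1, hx.2⟩) subset_rfl
  refine (r1.trans r2).mono subset_rfl ?_
  rintro x ⟨h1, h2⟩
  have := abs_le.1 (hclose x)
  exact ⟨h1, by linarith [this.1, this.2]⟩

/-- chaining the progress steps -/
lemma chain {N : ℕ} {R : ℝ} {X Y : Set (Cn N)} (φ : Cn N → ℝ) (c0 c1 : ℝ)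
    (h : ∀ b, c0 ≤ b → b ≤ c1 → ∃ κ > 0, Reach R Y {x ∈ X | b - κ < φ x} {x ∈ X | b + κ < φ x}) :
    Reach R Y {x ∈ X | c0 < φ x} {x ∈ X | c1 < φ x} := by
  rcases lt_or_ge c1 c0 with hlt | hle
  · exact Reach.refl' fun x hx => ⟨hx.1, hlt.trans hx.2⟩
  set A := {b | c0 ≤ b ∧ b ≤ c1 ∧ Reach R Y {x ∈ X | c0 < φ x} {x ∈ X | b < φ x}} with hA
  have hA0 : c0 ∈ A := ⟨le_rfl, hle, Reach.refl' subset_rfl⟩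
  have hbdd : BddAbove A := ⟨c1, fun b hb => hb.2.1⟩
  set s := sSup A
  have hs0 : c0 ≤ s := le_csSup hbdd hA0
  have hs1 : s ≤ c1 := csSup_le ⟨c0, hA0⟩ fun b hb => hb.2.1
  obtain ⟨κ, hκ, hr⟩ := h s hs0 hs1
  obtain ⟨b, hb, hbs⟩ := exists_lt_of_lt_csSup ⟨c0, hA0⟩ (by linarith : s - κ < s)
  have h1 : Reach R Y {x ∈ X | c0 < φ x} {x ∈ X | s + κ < φ x} :=
    hb.2.2.trans (hr.mono (fun x hx => ⟨hx.1, hbs.trans hx.2⟩) subset_rfl)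
  by_contra hcon
  have h2 : s + κ ≤ c1 := by
    by_contra h3
    push Not at h3
    exact hcon (h1.mono subset_rfl fun x hx => ⟨hx.1, h3.trans hx.2⟩)
  have : s + κ ≤ s := le_csSup hbdd ⟨by linarith, h2, h1⟩
  linarith
end

noncomputable section
open Set Filter Complex Metric
open scoped ENNReal Topology

lemma sard_pick {E : Type*} [NormedAddCommGroup E] [NormedSpace ℝ E] [FiniteDimensional ℝ E] (X : Set E)
    (ρ : E → ℝ) (hρ : ∀ x ∈ X, ContDiffAt ℝ 2 ρ x) (δ : ℝ) (hδ : 0 < δ) :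
    ∃ l : E →L[ℝ] ℝ, ‖l‖ < δ ∧ ∀ x ∈ X, fderiv ℝ ρ x = l →
      ∀ u, (∀ v, fderiv ℝ (fderiv ℝ ρ) x u v = 0) → u = 0 := by
  borelize E
  have hfr : Module.finrank ℝ (E →L[ℝ] ℝ) = Module.finrank ℝ E := by
    rw [← Subspace.dual_finrank_eq (K := ℝ) (V := E)]
    exact (LinearMap.toContinuousLinearMap (𝕜 := ℝ) (E := E) (F' := ℝ)).symm.finrank_eq
  let ι : (E →L[ℝ] ℝ) ≃L[ℝ] E := ContinuousLinearEquiv.ofFinrankEq hfr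
  set s := {x ∈ X | ∃ u, u ≠ 0 ∧ fderiv ℝ (fderiv ℝ ρ) x u = 0} with hs
  have hder : ∀ x ∈ s, HasFDerivWithinAt (fun x => ι (fderiv ℝ ρ x))
      ((ι : (E →L[ℝ] ℝ) →L[ℝ] E).comp (fderiv ℝ (fderiv ℝ ρ) x)) s x := by
    intro x hx
    have hd1 : ContDiffAt ℝ 1 (fderiv ℝ ρ) x := (hρ x hx.1).fderiv_right (by norm_num)
    have := (hd1.differentiableAt (by norm_num)).hasFDerivAt
    exact ((ι : (E →L[ℝ] ℝ) →L[ℝ] E).hasFDerivAt.comp x this).hasFDerivWithinAt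
  have h0 := MeasureTheory.addHaar_image_eq_zero_of_det_fderivWithin_eq_zero
    (MeasureTheory.Measure.addHaar : MeasureTheory.Measure E) hder (by
      intro x hx
      obtain ⟨-, u, hu, hHu⟩ := hx
      by_contra hdet
      have hinj : Function.Injective ((ι : (E →L[ℝ] ℝ) →L[ℝ] E).comp (fderiv ℝ (fderiv ℝ ρ) x)) := by
        have hdet' : LinearMap.det (((ι : (E →L[ℝ] ℝ) →L[ℝ] E).comp (fderiv ℝ (fderiv ℝ ρ) x) : E →L[ℝ] E) : E →ₗ[ℝ] E) ≠ 0 := hdet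
        exact (LinearEquiv.ofIsUnitDet (v := Module.finBasis ℝ E) (v' := Module.finBasis ℝ E)
          (f := (((ι : (E →L[ℝ] ℝ) →L[ℝ] E).comp (fderiv ℝ (fderiv ℝ ρ) x) : E →L[ℝ] E) : E →ₗ[ℝ] E)) (by
            rw [LinearMap.det_toMatrix]; exact hdet'.isUnit)).injective
      apply hu
      apply hinj
      simp [hHu])
  have hδ' : ∃ r > 0, ∀ w : E, ‖w‖ < r → ‖ι.symm w‖ < δ := by
    have hc : ContinuousAt ι.symm 0 := ι.symm.continuous.continuousAt
    obtain ⟨r, hr, h⟩ := Metric.continuousAt_iff.1 hc δ hδ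
    refine ⟨r, hr, fun w hw => ?_⟩
    have := @h w (by simpa using hw)
    rw [map_zero] at this
    exact (le_of_eq (dist_zero_right (E := E →L[ℝ] ℝ) _).symm).trans_lt this
  obtain ⟨r, hr, hr2⟩ := hδ'
  have hex : ∃ w ∈ ball (0:E) r, w ∉ (fun x => ι (fderiv ℝ ρ x)) '' s := by
    by_contra hcon
    push Not at hcon
    have h1 : (MeasureTheory.Measure.addHaar : MeasureTheory.Measure E) (ball (0:E) r) ≤ 0 := by
      rw [← h0]; exact MeasureTheory.measure_mono hcon
    exact absurd h1 (not_le.2 (Metric.measure_ball_pos _ _ hr))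
  obtain ⟨w, hw, hws⟩ := hex
  refine ⟨ι.symm w, hr2 w (by simpa using hw), fun x hx hxl u hu => ?_⟩
  by_contra hne
  apply hws
  refine ⟨x, ⟨hx, u, hne, ?_⟩, ?_⟩
  · ext v; simpa using hu v
  · change ι (fderiv ℝ ρ x) = w
    rw [hxl]; exact ι.apply_symm_apply w

lemma stage {N : ℕ} {R : ℝ} (hR : 1 < R) {X : Set (Cn N)} (hX : IsOpen X) (ρ : Cn N → ℝ)
    (hρ : ∀ x ∈ X, ContDiffAt ℝ 2 ρ x) (hexh : ∀ c : ℝ, IsCompact {x ∈ X | ρ x ≤ c})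
    (hL : ∀ x ∈ X, TwoPosEigen ρ x) (c0 c1 : ℝ) :
    Reach R {x ∈ X | c0 - 1 < ρ x} {x ∈ X | c0 < ρ x} {x ∈ X | c1 < ρ x} := by
  have hρc : ContinuousOn ρ X := fun x hx => (hρ x hx).continuousAt.continuousWithinAt
  obtain ⟨M, hM⟩ := (hexh (c1 + 1)).isBounded.exists_norm_le
  set M' := max M 0 with hM'
  have hM'0 : 0 ≤ M' := le_max_right _ _
  obtain ⟨l, hl, hsard⟩ := sard_pick X ρ hρ (1 / (8 * (M' + 1))) (by positivity)
  have hlb : ∀ x ∈ X, ρ x ≤ c1 + 1 → |l x| < 1/8 := by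
    intro x hx hx1
    have h1 : ‖x‖ ≤ M' := (hM x ⟨hx, hx1⟩).trans (le_max_left _ _)
    have h2 := l.le_opNorm x
    rw [Real.norm_eq_abs] at h2
    calc |l x| ≤ ‖l‖ * ‖x‖ := h2
      _ ≤ ‖l‖ * (M' + 1) := by gcongr; linarith
      _ < 1 / (8 * (M' + 1)) * (M' + 1) := by gcongr
      _ = 1/8 := by field_simp
  set φ : Cn N → ℝ := fun x => ρ x - max (-(1/8)) (min (1/8) (l x)) with hφ
  have hclose : ∀ x, |φ x - ρ x| ≤ 1/8 := by
    intro x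
    have e : φ x - ρ x = - max (-(1/8)) (min (1/8) (l x)) := by rw [hφ]; ring
    rw [e, abs_neg, abs_le]
    exact ⟨le_max_left _ _, max_le (by norm_num) (min_le_left _ _)⟩
  have hφc : ContinuousOn φ X :=
    hρc.sub (continuous_const.max (continuous_const.min l.continuous)).continuousOn
  have hev : ∀ x ∈ X, ρ x ≤ c1 + 1 → φ =ᶠ[𝓝 x] fun y => ρ y - l y := by
    intro x hx hx1
    have h1 : ∀ᶠ y in 𝓝 x, |l y| < 1/8 :=
      (l.continuous.abs.continuousAt).eventually (Iio_mem_nhds (hlb x hx hx1))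
    filter_upwards [h1] with y hy
    have := abs_lt.1 hy
    change ρ y - max (-(1/8)) (min (1/8) (l y)) = _
    rw [min_eq_right this.2.le, max_eq_right this.1.le]
  have hY : IsOpen {x ∈ X | c0 - 1 < ρ x} := isOpen_level hX hρc _
  have hch : Reach R {x ∈ X | c0 - 1 < ρ x} {x ∈ X | c0 - 1/8 < φ x} {x ∈ X | c1 + 1/8 < φ x} := by
    refine chain φ _ _ fun b hb0 hb1 => ?_
    refine progress hR hX hY φ hφc b (1/8) (by norm_num) ?_ ?_ ?_
    · have e : {x ∈ X | b - 1/8 ≤ φ x ∧ φ x ≤ b + 1/8} =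
          {x ∈ X | ρ x ≤ c1 + 1} ∩ φ ⁻¹' (Icc (b - 1/8) (b + 1/8)) := by
        ext x
        constructor
        · rintro ⟨h1, h2, h3⟩
          have := abs_le.1 (hclose x)
          exact ⟨⟨h1, by linarith [this.1, this.2]⟩, h2, h3⟩
        · rintro ⟨⟨h1, -⟩, h2, h3⟩
          exact ⟨h1, h2, h3⟩
      rw [e]
      refine (hexh (c1 + 1)).of_isClosed_subset ?_ inter_subset_left
      exact (hφc.mono (sep_subset _ _)).preimage_isClosed_of_isClosed (hexh (c1 + 1)).isClosed isClosed_Icc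
    · intro x hx h1 h2
      have hcl := abs_le.1 (hclose x)
      have hx1 : ρ x ≤ c1 + 1 := by linarith [hcl.1, hcl.2]
      have he := hev x hx hx1
      have hlc : ContDiffAt ℝ 2 (fun y => l y) x := l.contDiff.contDiffAt
      have hd : fderiv ℝ φ =ᶠ[𝓝 x] fun y => fderiv ℝ ρ y - l := by
        have h3 : ∀ᶠ y in 𝓝 x, y ∈ X := hX.mem_nhds hx
        filter_upwards [he.fderiv (𝕜 := ℝ), h3] with y hy hyX
        rw [hy, fderiv_fun_sub ((hρ y hyX).differentiableAt (by norm_num)) l.differentiableAt]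
        rw [l.fderiv]
      have hd2 : fderiv ℝ (fderiv ℝ φ) x = fderiv ℝ (fderiv ℝ ρ) x := by
        rw [hd.fderiv_eq]
        exact fderiv_sub_const (𝕜 := ℝ) l
      refine ⟨((hρ x hx).sub hlc).congr_of_eventuallyEq he, ?_, ?_⟩
      · obtain ⟨W, w1, w2⟩ := hL x hx
        refine ⟨W, w1, fun v hv hne => ?_⟩
        have := w2 v hv hne
        rw [levi_eq] at this ⊢
        rwa [hd2]
      · intro h0
        rw [hd2]
        refine hsard x hx ?_
        rw [hd.eq_of_nhds] at h0
        exact sub_eq_zero.1 h0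
    · rintro x ⟨h1, h2⟩
      have hcl := abs_le.1 (hclose x)
      exact ⟨h1, by linarith [hcl.1, hcl.2]⟩
  refine hch.mono ?_ ?_
  · rintro x ⟨h1, h2⟩
    have hcl := abs_le.1 (hclose x)
    exact ⟨h1, by linarith [hcl.1, hcl.2]⟩
  · rintro x ⟨h1, h2⟩
    have hcl := abs_le.1 (hclose x)
    exact ⟨h1, by linarith [hcl.1, hcl.2]⟩
end

noncomputable section
open Set Filter Complex Metric
open scoped ENNReal Topology

lemma seq_of_step {α : Type*} (P : ℕ → α → Prop) (Q : ℕ → α → α → Prop) (a0 : α) (h0 : P 0 a0)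
    (h : ∀ n a, P n a → ∃ a', P (n + 1) a' ∧ Q n a a') :
    ∃ u : ℕ → α, (∀ n, P n (u n)) ∧ ∀ n, Q n (u n) (u (n + 1)) := by
  choose! g hg using h
  let u : ℕ → α := fun n => Nat.rec a0 (fun n a => g n a) n
  have hu : ∀ n, u (n + 1) = g n (u n) := fun n => rfl
  have hP : ∀ n, P n (u n) := by
    intro n
    induction n with
    | zero => exact h0
    | succ k ih => rw [hu]; exact (hg k _ ih).1
  exact ⟨u, hP, fun n => by rw [hu]; exact (hg n _ (hP n)).2⟩

lemma exists_delta {N : ℕ} {X : Set (Cn N)} (hX : IsOpen X) (ρ : Cn N → ℝ) (hρ : ContinuousOn ρ X)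
    (L : Set (Cn N)) (hL : IsCompact L) (hLX : L ⊆ X) :
    ∃ δ > 0, ∀ x ∈ L, ∀ y, ‖y - x‖ ≤ δ → y ∈ X ∧ ρ x - 1 < ρ y := by
  obtain ⟨δ1, hδ1, hsub⟩ := hL.exists_cthickening_subset_open hX hLX
  have hc : IsCompact (cthickening δ1 L) := hL.cthickening
  have hu := hc.uniformContinuousOn_of_continuous (hρ.mono hsub)
  obtain ⟨δ2, hδ2, hd⟩ := Metric.uniformContinuousOn_iff.1 hu 1 one_pos
  refine ⟨min δ1 (δ2 / 2), by positivity, fun x hx y hy => ?_⟩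
  have hy1 : y ∈ cthickening δ1 L :=
    mem_cthickening_of_dist_le y x δ1 L hx (by rw [dist_eq_norm]; exact hy.trans (min_le_left _ _))
  have hx1 : x ∈ cthickening δ1 L := self_subset_cthickening L hx
  refine ⟨hsub hy1, ?_⟩
  have := hd y hy1 x hx1 (by
    rw [dist_eq_norm]
    have := hy.trans (min_le_right _ _)
    linarith)
  rw [Real.dist_eq] at this
  linarith [(abs_lt.1 this).1]

lemma exists_radius {N : ℕ} {X : Set (Cn N)} (ρ : Cn N → ℝ) (hρ : ContinuousOn ρ X) (F : ℂ → Cn N)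
    (hF : ContinuousOn F (closedBall 0 1)) (hFX : ∀ z, ‖z‖ ≤ 1 → F z ∈ X) (c t : ℝ) (ht : t < 1)
    (hc : ∀ z, ‖z‖ = 1 → c < ρ (F z)) : ∃ r, t < r ∧ r < 1 ∧ ∀ z, r ≤ ‖z‖ → ‖z‖ ≤ 1 → c < ρ (F z) := by
  have hcomp : ContinuousOn (fun z => ρ (F z)) (closedBall 0 1) :=
    hρ.comp hF fun z hz => hFX z (by simpa using hz)
  have hK : IsCompact (closedBall (0:ℂ) 1 ∩ (fun z => ρ (F z)) ⁻¹' Iic c) :=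
    (isCompact_closedBall 0 1).of_isClosed_subset
      (hcomp.preimage_isClosed_of_isClosed isClosed_closedBall isClosed_Iic) inter_subset_left
  obtain ⟨m, hm, hmb⟩ : ∃ m < 1, ∀ z ∈ closedBall (0:ℂ) 1 ∩ (fun z => ρ (F z)) ⁻¹' Iic c, ‖z‖ ≤ m := by
    rcases (closedBall (0:ℂ) 1 ∩ (fun z => ρ (F z)) ⁻¹' Iic c).eq_empty_or_nonempty with he | hne
    · exact ⟨0, by norm_num, by simp [he]⟩
    · obtain ⟨z, hz, hmax⟩ := hK.exists_isMaxOn hne continuous_norm.continuousOn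
      refine ⟨‖z‖, ?_, fun w hw => hmax hw⟩
      have h1 : ‖z‖ ≤ 1 := by simpa using hz.1
      refine lt_of_le_of_ne h1 fun h => ?_
      have h2 : ρ (F z) ≤ c := hz.2
      linarith [hc z h]
  refine ⟨(max m t + 1) / 2, ?_, ?_, fun z hz hz1 => ?_⟩
  · have := le_max_right m t; linarith
  · have := max_lt hm ht; linarith
  · by_contra hcon
    push Not at hcon
    have h1 := hmb z ⟨by simpa using hz1, hcon⟩
    have h2 := le_max_left m t
    have := max_lt hm ht
    linarith

lemma proper_disc {N : ℕ} {R : ℝ} (hR : 1 < R) {X : Set (Cn N)} (hX : IsOpen X) (ρ : Cn N → ℝ)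
    (hρ : ∀ x ∈ X, ContDiffAt ℝ 2 ρ x) (hexh : ∀ c : ℝ, IsCompact {x ∈ X | ρ x ≤ c})
    (hL : ∀ x ∈ X, TwoPosEigen ρ x) (g : ℂ → Cn N) (hg : DifferentiableOn ℂ g (ball 0 R))
    (hgX : ∀ z, ‖z‖ ≤ 1 → g z ∈ X) :
    ∃ F : ℂ → Cn N, DifferentiableOn ℂ F (ball 0 1) ∧ (∀ z ∈ ball (0:ℂ) 1, F z ∈ X) ∧ F 0 = g 0 ∧
      deriv F 0 = deriv g 0 ∧ ∀ K : Set (Cn N), K ⊆ X → IsCompact K → IsCompact {z ∈ ball (0:ℂ) 1 | F z ∈ K} := by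
  have hρc : ContinuousOn ρ X := fun x hx => (hρ x hx).continuousAt.continuousWithinAt
  have hsubR : closedBall (0:ℂ) 1 ⊆ ball 0 R := closedBall_subset_ball hR
  have hcb : ∀ f : ℂ → Cn N, DifferentiableOn ℂ f (ball 0 R) → ContinuousOn f (closedBall 0 1) :=
    fun f hf => hf.continuousOn.mono hsubR
  -- delta for a disc
  have hdel : ∀ f : ℂ → Cn N, DifferentiableOn ℂ f (ball 0 R) → (∀ z, ‖z‖ ≤ 1 → f z ∈ X) →
      ∃ δ > 0, ∀ z, ‖z‖ ≤ 1 → ∀ y, ‖y - f z‖ ≤ δ → y ∈ X ∧ ρ (f z) - 1 < ρ y := by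
    intro f hf hfX
    obtain ⟨δ, hδ, h⟩ := exists_delta hX ρ hρc (f '' closedBall 0 1)
      ((isCompact_closedBall 0 1).image_of_continuousOn (hcb f hf)) (by
        rintro _ ⟨z, hz, rfl⟩; exact hfX z (by simpa using hz))
    exact ⟨δ, hδ, fun z hz y hy => h (f z) ⟨z, by simpa using hz, rfl⟩ y hy⟩
  -- starting level
  obtain ⟨c, hc⟩ : ∃ c : ℝ, ∀ z, ‖z‖ ≤ 1 → c < ρ (g z) := by
    have hcomp : ContinuousOn (fun z => ρ (g z)) (closedBall 0 1) :=
      hρc.comp (hcb g hg) fun z hz => hgX z (by simpa using hz)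
    obtain ⟨z, hz, hmin⟩ := (isCompact_closedBall (0:ℂ) 1).exists_isMinOn ⟨0, by simp⟩ hcomp
    refine ⟨ρ (g z) - 1, fun w hw => ?_⟩
    have : ρ (g z) ≤ ρ (g w) := hmin (by simpa using hw)
    linarith
  let P : ℕ → ((ℂ → Cn N) × ℝ × ℝ) → Prop := fun k s =>
    DifferentiableOn ℂ s.1 (ball 0 R) ∧ 0 < s.2.1 ∧ s.2.1 < 1 ∧ 1 - 1 / ((k:ℝ) + 1) ≤ s.2.1 ∧ 0 < s.2.2 ∧
      (∀ z, ‖z‖ ≤ 1 → s.1 z ∈ X) ∧ (∀ z, s.2.1 ≤ ‖z‖ → ‖z‖ ≤ 1 → c + k < ρ (s.1 z)) ∧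
      (∀ z, ‖z‖ ≤ 1 → ∀ y, ‖y - s.1 z‖ ≤ 2 * s.2.2 → y ∈ X ∧ ρ (s.1 z) - 1 < ρ y) ∧
      s.1 0 = g 0 ∧ deriv s.1 0 = deriv g 0
  let Q : ℕ → ((ℂ → Cn N) × ℝ × ℝ) → ((ℂ → Cn N) × ℝ × ℝ) → Prop := fun k s s' =>
    s.2.1 < s'.2.1 ∧ s'.2.2 ≤ s.2.2 / 2 ∧ (∀ z, ‖z‖ ≤ s.2.1 → ‖s'.1 z - s.1 z‖ < s.2.2) ∧
      (∀ z, s.2.1 ≤ ‖z‖ → ‖z‖ ≤ 1 → c + k - 1 < ρ (s'.1 z))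
  obtain ⟨δ0, hδ0, hδ0'⟩ := hdel g hg hgX
  obtain ⟨u, hP, hQ⟩ := seq_of_step P Q (g, 1/2, δ0 / 2)
    (by
      refine ⟨hg, by norm_num, by norm_num, by norm_num, by positivity, hgX, fun z _ hz => by simpa using hc z hz,
        fun z hz y hy => hδ0' z hz y (by linarith), rfl, rfl⟩)
    (by
      rintro k ⟨f, r, ε⟩ ⟨hf, hr0, hr1, -, hε, hfX, hfc, hfδ, hf0, hf0'⟩
      simp only at hf hr0 hr1 hε hfX hfc hfδ hf0 hf0'
      obtain ⟨F, hFd, hF0, hF0', hFε, hFY, hFO⟩ := stage hR hX ρ hρ hexh hL (c + k) (c + (k + 1)) f hf r hr0 hr1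
        (fun z h1 h2 => ⟨hfX z h2, by linarith [hfc z h1 h2]⟩)
        (fun z hz => ⟨hfX z hz.le, hfc z (by rw [hz]; exact hr1.le) hz.le⟩) ε hε
      have hFX : ∀ z, ‖z‖ ≤ 1 → F z ∈ X := by
        intro z hz
        rcases le_total ‖z‖ r with h | h
        · exact (hfδ z hz (F z) (by linarith [hFε z h])).1
        · exact (hFY z h hz).1
      obtain ⟨r', hr', hr'1, hr'c⟩ := exists_radius ρ hρc F (hcb F hFd) hFX (c + (k + 1))
        (max r (1 - 1 / ((k:ℝ) + 1 + 1))) (max_lt hr1 (by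
          have : 0 < 1 / ((k:ℝ) + 1 + 1) := by positivity
          linarith)) (fun z hz => (hFO z hz).2)
      obtain ⟨δ, hδ, hδ'⟩ := hdel F hFd hFX
      have hrr' : r < r' := (le_max_left _ _).trans_lt hr'
      refine ⟨(F, r', min (ε / 2) (δ / 2)), ⟨hFd, hr0.trans hrr', hr'1, ?_, by positivity, hFX, ?_, ?_,
        hF0.trans hf0, hF0'.trans hf0'⟩, hrr', min_le_left _ _, hFε, fun z h1 h2 => (hFY z h1 h2).2⟩
      · push_cast; exact ((le_max_right _ _).trans_lt hr').le
      · intro z h1 h2; push_cast; exact hr'c z h1 h2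
      · intro z hz y hy
        have := min_le_right (ε / 2) (δ / 2)
        exact hδ' z hz y (by simp only at hy; linarith))
  set f : ℕ → ℂ → Cn N := fun k => (u k).1 with hfd
  set r : ℕ → ℝ := fun k => (u k).2.1 with hrd
  set ε : ℕ → ℝ := fun k => (u k).2.2 with hεd
  have hf : ∀ k, DifferentiableOn ℂ (f k) (ball 0 R) := fun k => (hP k).1
  have hr1 : ∀ k, r k < 1 := fun k => (hP k).2.2.1
  have hrlow : ∀ k : ℕ, 1 - 1 / ((k:ℝ) + 1) ≤ r k := fun k => (hP k).2.2.2.1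
  have hε0 : ∀ k, 0 < ε k := fun k => (hP k).2.2.2.2.1
  have hfδ : ∀ k, ∀ z, ‖z‖ ≤ 1 → ∀ y, ‖y - f k z‖ ≤ 2 * ε k → y ∈ X ∧ ρ (f k z) - 1 < ρ y :=
    fun k => (hP k).2.2.2.2.2.2.2.1
  have hf0 : ∀ k, f k 0 = g 0 := fun k => (hP k).2.2.2.2.2.2.2.2.1
  have hf0' : ∀ k, deriv (f k) 0 = deriv g 0 := fun k => (hP k).2.2.2.2.2.2.2.2.2
  have hrlt : ∀ k, r k < r (k + 1) := fun k => (hQ k).1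
  have hrmono : Monotone r := monotone_nat_of_le_succ fun k => (hrlt k).le
  have hεhalf : ∀ k, ε (k + 1) ≤ ε k / 2 := fun k => (hQ k).2.1
  have hstep : ∀ k z, ‖z‖ ≤ r k → ‖f (k + 1) z - f k z‖ < ε k := fun k => (hQ k).2.2.1
  have hstepc : ∀ k z, r k ≤ ‖z‖ → ‖z‖ ≤ 1 → c + k - 1 < ρ (f (k + 1) z) := fun k => (hQ k).2.2.2
  have hεgeo : ∀ k j, ε (k + j) ≤ ε k * (1/2)^j := by
    intro k j
    induction j with
    | zero => simp
    | succ j ih =>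
      have h1 := hεhalf (k + j)
      have h2 : ε k * (1/2)^(j+1) = ε k * (1/2)^j / 2 := by rw [pow_succ]; ring
      rw [h2, ← add_assoc]; linarith
  have hrex : ∀ z : ℂ, ‖z‖ < 1 → ∃ k, ‖z‖ < r k := by
    intro z hz
    obtain ⟨k, hk⟩ := exists_nat_one_div_lt (show 0 < 1 - ‖z‖ by linarith)
    exact ⟨k, by linarith [hrlow k]⟩
  have hgeo : ∀ k z, ‖z‖ ≤ r k → ∀ j, dist (f (k + j) z) (f (k + (j + 1)) z) ≤ ε k * (1/2)^j := by
    intro k z hz j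
    rw [dist_comm, dist_eq_norm, ← add_assoc]
    exact (hstep (k + j) z (hz.trans (hrmono (by omega)))).le.trans (hεgeo k j)
  have hlim : ∀ z : ℂ, ∃ y, ‖z‖ < 1 → Tendsto (fun j => f j z) atTop (𝓝 y) := by
    intro z
    by_cases hz : ‖z‖ < 1
    · obtain ⟨k, hk⟩ := hrex z hz
      have hcau : CauchySeq (fun j => f (k + j) z) :=
        cauchySeq_of_le_geometric (1/2) (ε k) (by norm_num) (hgeo k z hk.le)
      obtain ⟨y, hy⟩ := cauchySeq_tendsto_of_complete hcau
      refine ⟨y, fun _ => ?_⟩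
      refine (tendsto_add_atTop_iff_nat k).1 ?_
      refine hy.congr fun j => ?_
      rw [add_comm]
    · exact ⟨0, fun h => absurd h hz⟩
  choose F hF using hlim
  have hFk : ∀ k z, ‖z‖ ≤ r k → ‖F z - f k z‖ ≤ 2 * ε k := by
    intro k z hz
    have ht := hF z (hz.trans_lt (hr1 k))
    have ht' : Tendsto (fun j => f (k + j) z) atTop (𝓝 (F z)) := by
      have := (tendsto_add_atTop_iff_nat k).2 ht
      refine this.congr fun j => ?_
      rw [add_comm]
    have := dist_le_of_le_geometric_of_tendsto₀ (1/2) (ε k) (by norm_num) (hgeo k z hz) ht'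
    rw [dist_comm, dist_eq_norm] at this
    simp only [add_zero] at this
    calc _ ≤ _ := this
      _ = _ := by ring
  have hε_t : Tendsto ε atTop (𝓝 0) := by
    have h1 : Tendsto (fun j : ℕ => ε 0 * (1/2 : ℝ)^j) atTop (𝓝 0) := by
      simpa using (tendsto_pow_atTop_nhds_zero_of_lt_one (by norm_num : (0:ℝ) ≤ 1/2) (by norm_num)).const_mul (ε 0)
    refine squeeze_zero (fun j => (hε0 j).le) (fun j => ?_) h1
    simpa using hεgeo 0 j
  have hunif : TendstoLocallyUniformlyOn f F atTop (ball 0 1) := by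
    rw [Metric.tendstoLocallyUniformlyOn_iff]
    intro e he z hz
    obtain ⟨k, hk⟩ := hrex z (by simpa using hz)
    refine ⟨ball 0 (r k), mem_nhdsWithin_of_mem_nhds (isOpen_ball.mem_nhds (by simpa using hk)), ?_⟩
    have h1 : ∀ᶠ j in atTop, ε j < e / 2 := hε_t.eventually (Iio_mem_nhds (by positivity))
    filter_upwards [h1, eventually_ge_atTop k] with j hj hkj w hw
    rw [dist_eq_norm]
    have hw' : ‖w‖ < r k := by simpa using hw
    have := hFk j w (hw'.le.trans (hrmono hkj))
    linarith
  have hball1 : ball (0:ℂ) 1 ⊆ ball 0 R := ball_subset_ball hR.le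
  have hdk : ∀ᶠ n in atTop, DifferentiableOn ℂ (f n) (ball 0 1) := Eventually.of_forall fun n => (hf n).mono hball1
  have hFd : DifferentiableOn ℂ F (ball 0 1) := hunif.differentiableOn hdk isOpen_ball
  have hFder := hunif.deriv hdk isOpen_ball
  have h0mem : (0:ℂ) ∈ ball (0:ℂ) 1 := by simp
  -- F in X
  have hFX : ∀ z, ‖z‖ < 1 → F z ∈ X := by
    intro z hz
    obtain ⟨k, hk⟩ := hrex z hz
    exact (hfδ k z hz.le (F z) (hFk k z hk.le)).1
  have hFρ : ∀ k z, r k < ‖z‖ → ‖z‖ < 1 → c + k - 2 < ρ (F z) := by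
    intro k z hk hz
    have hex : ∃ m, ‖z‖ ≤ r m := by obtain ⟨m, hm⟩ := hrex z hz; exact ⟨m, hm.le⟩
    classical
    have hm := Nat.find_spec hex
    set m := Nat.find hex with hmd
    have hkm : k < m := by
      by_contra hcon
      push Not at hcon
      linarith [hrmono hcon]
    obtain ⟨j, hj⟩ : ∃ j, m = j + 1 := ⟨m - 1, by omega⟩
    have hjz : r j < ‖z‖ := by
      have := Nat.find_min hex (m := j) (by omega)
      push Not at this; exact this
    have h1 := hstepc j z hjz.le hz.le
    rw [hj] at hm
    have h2 := (hfδ (j + 1) z hz.le (F z) (hFk (j + 1) z hm)).2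
    have h3 : (k:ℝ) ≤ j := by exact_mod_cast (by omega : k ≤ j)
    linarith
  refine ⟨F, hFd, fun z hz => hFX z (by simpa using hz), ?_, ?_, ?_⟩
  · have := hF 0 (by simp)
    simp only [hf0] at this
    exact tendsto_nhds_unique this tendsto_const_nhds
  · have := hFder.tendsto_at h0mem
    simp only [Function.comp_def, hf0'] at this
    exact tendsto_nhds_unique this tendsto_const_nhds
  · intro K hKX hK
    obtain ⟨C, hC⟩ := (hK.image_of_continuousOn (hρc.mono hKX)).bddAbove
    obtain ⟨k, hk⟩ := exists_nat_ge (C - c + 2)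
    have hsub : ∀ z, ‖z‖ < 1 → F z ∈ K → ‖z‖ ≤ r k := by
      intro z hz hzK
      by_contra hcon
      push Not at hcon
      have h1 := hFρ k z hcon hz
      have h2 : ρ (F z) ≤ C := hC ⟨F z, hzK, rfl⟩
      linarith
    have e : {z ∈ ball (0:ℂ) 1 | F z ∈ K} = closedBall 0 (r k) ∩ F ⁻¹' K := by
      ext z
      constructor
      · rintro ⟨h1, h2⟩
        exact ⟨by simpa using hsub z (by simpa using h1) h2, h2⟩
      · rintro ⟨h1, h2⟩
        have h1' : ‖z‖ ≤ r k := by simpa using h1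
        exact ⟨by simpa using h1'.trans_lt (hr1 k), h2⟩
    rw [e]
    refine (isCompact_closedBall 0 (r k)).of_isClosed_subset ?_ inter_subset_left
    exact (hFd.continuousOn.mono (closedBall_subset_ball (hr1 k))).preimage_isClosed_of_isClosed
      isClosed_closedBall hK.isClosed

lemma final_thm
    (N : ℕ) (X : Set (Cn N)) (hXopen : IsOpen X)
    (ρ : Cn N → ℝ) (hρ : ContDiffOn ℝ (⊤ : ℕ∞) ρ X)
    (hexh : ∀ c : ℝ, IsCompact {x ∈ X | ρ x ≤ c})
    (hLevi : ∀ x ∈ X, TwoPosEigen ρ x)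
    (x : Cn N) (v : Cn N) :
    kob X x v false = kob X x v true := by
  have hρ2 : ∀ x ∈ X, ContDiffAt ℝ 2 ρ x := fun x hx =>
    ((hρ.contDiffAt (hXopen.mem_nhds hx)).of_le (by exact WithTop.coe_le_coe.2 (le_top : (2:ℕ∞) ≤ ⊤)))
  have hkey : ∀ lam ∈ kobSet X x v false, ∀ lam' > lam, lam' ∈ kobSet X x v true := by
    rintro lam ⟨hlam, f, hf, hfX, hf0, hf0', -⟩ lam' hlt
    have hlam' : 0 < lam' := hlam.trans hlt
    set r : ℝ := lam / lam' with hr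
    have hr0 : 0 < r := by positivity
    have hr1 : r < 1 := by rw [hr, div_lt_one hlam']; exact hlt
    have hR : 1 < 1 / r := by rw [one_lt_div hr0]; exact hr1
    have hnorm : ∀ z : ℂ, ‖(r:ℂ) * z‖ = r * ‖z‖ := fun z => by
      rw [norm_mul, Complex.norm_real, Real.norm_of_nonneg hr0.le]
    have hmaps : ∀ z ∈ ball (0:ℂ) (1 / r), (r:ℂ) * z ∈ ball (0:ℂ) 1 := by
      intro z hz
      have hz' : ‖z‖ < 1 / r := by simpa using hz
      rw [mem_ball_zero_iff, hnorm]
      rwa [lt_div_iff₀ hr0, mul_comm] at hz'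
    have hg : DifferentiableOn ℂ (fun z => f ((r:ℂ) * z)) (ball 0 (1 / r)) :=
      hf.comp (differentiableOn_id.const_mul (r:ℂ)) hmaps
    have hgX : ∀ z : ℂ, ‖z‖ ≤ 1 → f ((r:ℂ) * z) ∈ X := by
      intro z hz
      exact hfX _ (hmaps z (by simpa using hz.trans_lt (by simpa using hR)))
    obtain ⟨F, hFd, hFX, hF0, hF0', hFp⟩ := proper_disc hR hXopen ρ hρ2 hexh hLevi _ hg hgX
    refine ⟨hlam', F, hFd, hFX, ?_, ?_, fun _ => hFp⟩
    · rw [hF0]; simpa using hf0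
    · rw [hF0']
      have hfd : HasDerivAt f (deriv f 0) ((r:ℂ) * 0) := by
        rw [mul_zero]
        exact (hf.differentiableAt (isOpen_ball.mem_nhds (by simp))).hasDerivAt
      have hm : HasDerivAt (fun z : ℂ => (r:ℂ) * z) (r:ℂ) 0 := by
        simpa using (hasDerivAt_id (0:ℂ)).const_mul (r:ℂ)
      have := (hfd.scomp (0:ℂ) hm).deriv
      change deriv (f ∘ fun z => (r:ℂ) * z) 0 = _
      rw [this, hf0', smul_smul, hr]
      congr 1
      have h1 : (lam:ℂ) ≠ 0 := by exact_mod_cast hlam.ne'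
      have h2 : (lam':ℂ) ≠ 0 := by exact_mod_cast hlam'.ne'
      push_cast
      field_simp
  unfold kob
  apply le_antisymm
  · apply sInf_le_sInf
    apply image_mono
    rintro lam ⟨h1, f, h2, h3, h4, h5, -⟩
    exact ⟨h1, f, h2, h3, h4, h5, fun h => by cases h⟩
  · refine le_sInf ?_
    rintro _ ⟨lam, hlam, rfl⟩
    refine le_of_forall_gt_imp_ge_of_dense ?_
    intro a ha
    rcases eq_or_ne a ⊤ with rfl | hat
    · exact le_top
    · refine sInf_le ⟨a.toReal, hkey lam hlam _ ?_, ENNReal.ofReal_toReal hat⟩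
      have := (ENNReal.ofReal_lt_iff_lt_toReal hlam.1.le hat).1 ha
      exact this
end

/-- For a connected domain `X ⊆ ℂ^N` admitting a smooth exhaustion function
whose Levi form has at least two positive eigenvalues everywhere, the
infinitesimal Kobayashi–Royden pseudometric is computable by proper
holomorphic discs. -/
theorem kobayashi_by_proper_discs
    (N : ℕ) (hN : 2 ≤ N) (X : Set (Cn N)) (hXopen : IsOpen X) (hXconn : IsConnected X)
    (ρ : Cn N → ℝ) (hρ : ContDiffOn ℝ (⊤ : ℕ∞) ρ X)
    (hexh : ∀ c : ℝ, IsCompact {x ∈ X | ρ x ≤ c})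
    (hLevi : ∀ x ∈ X, TwoPosEigen ρ x)
    (x : Cn N) (hx : x ∈ X) (v : Cn N) :
    kob X x v false = kob X x v true := by
  exact final_thm N X hXopen ρ hρ hexh hLevi x v
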